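/- arXiv:math/0607788 — 3 statements merged into one kernel-verified Lean document; each statement's English description precedes it below -/
import Mathlib

section
/- Let V be a finite set of size n and g : V × V → ℝ symmetric with |Σ_y g(x,y)| ≤ μ·n for all x and Σ_y g(x,y)·g(y,z) ≤ ν·n for all x ≠ z, with μ ≥ 0 and 0 < ν ≤ 1. Then for every integer l ≥ 3, the cyclic sum satisfies |Σ_{y_1,...,y_l} g(y_1,y_2)·g(y_2,y_3)···g(y_l,y_1)| ≤ 2·ν^{⌊l/2⌋}·n^l + (2/ν)·n^{l-1}. -/
open Finset Matrix

theorem sum_prod_path {V R : Type*} [Fintype V] [DecidableEq V] [CommSemiring R]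
    (A : Matrix V V R) (m : ℕ) (f : V → V → R) :
    ∑ y : Fin (m + 1) → V,
        (∏ i : Fin m, A (y i.castSucc) (y i.succ)) * f (y 0) (y (Fin.last m)) =
      ∑ x, ∑ z, (A ^ m) x z * f x z := by
  induction m generalizing f with
  | zero =>
    rw [← (Equiv.funUnique (Fin 1) V).symm.sum_comp]
    simp [Matrix.one_apply]
  | succ m ih =>
    rw [← (Fin.consEquiv fun _ : Fin (m + 2) => V).sum_comp, Fintype.sum_prod_type_right]
    trans ∑ y : Fin (m + 1) → V, (∏ i : Fin m, A (y i.castSucc) (y i.succ)) *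
        (fun x z => ∑ a, A a x * f a z) (y 0) (y (Fin.last m))
    · refine sum_congr rfl fun y _ => ?_
      rw [mul_sum]
      refine sum_congr rfl fun a _ => ?_
      rw [Fin.prod_univ_succ]
      simp only [Fin.consEquiv_apply, Fin.castSucc_zero, Fin.cons_zero, Fin.cons_succ,
        ← Fin.succ_castSucc, ← Fin.succ_last]
      ring
    · refine (ih fun x z => ∑ a, A a x * f a z).trans ?_
      simp only [pow_succ', Matrix.mul_apply, sum_mul, mul_sum]
      rw [sum_comm_cycle]
      refine sum_congr rfl fun _ _ => ?_
      rw [sum_comm]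
      exact sum_congr rfl fun _ _ => sum_congr rfl fun _ _ => by ring

theorem sum_prod_finRotate_eq_trace_pow {V R : Type*} [Fintype V] [DecidableEq V]
    [CommSemiring R] (A : Matrix V V R) {l : ℕ} (hl : l ≠ 0) :
    ∑ y : Fin l → V, ∏ i : Fin l, A (y i) (y (finRotate l i)) = (A ^ l).trace := by
  obtain ⟨m, rfl⟩ := Nat.exists_eq_succ_of_ne_zero hl
  simp only [Nat.succ_eq_add_one, Fin.prod_univ_castSucc, finRotate_apply, Fin.coeSucc_eq_succ]
  simpa [pow_succ, trace, Matrix.mul_apply] using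
    sum_prod_path A m fun x z => A z x

theorem trace_pow_eq_sum_eigenvalues_pow {V : Type*} [Fintype V] [DecidableEq V]
    {A : Matrix V V ℝ} (hA : A.IsHermitian) (l : ℕ) :
    (A ^ l).trace = ∑ i, hA.eigenvalues i ^ l := by
  conv_lhs => rw [hA.spectral_theorem, ← map_pow, Unitary.conjStarAlgAut_apply,
    trace_mul_cycle, Unitary.coe_star_mul_self, one_mul, diagonal_pow, trace_diagonal]
  simp

theorem pow_lineMap_one_le {c ν : ℝ} (hc0 : 0 ≤ c) (hc1 : c ≤ 1) (hν0 : 0 ≤ ν) (j : ℕ) :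
    (ν + c * (1 - ν)) ^ j ≤ ν ^ j + c * (1 - ν ^ j) := by
  have h := (convexOn_pow j).2 (x := ν) (y := 1) hν0 (zero_le_one' ℝ) (sub_nonneg.2 hc1) hc0
    (by ring)
  simp only [smul_eq_mul, one_pow] at h
  rw [show ν + c * (1 - ν) = (1 - c) * ν + c * 1 by ring]
  linarith

theorem sum_pow_le {ι : Type*} [Fintype ι] {β : ι → ℝ} {ν e : ℝ} (hν0 : 0 < ν) (hν1 : ν ≤ 1)
    (he0 : 0 < e) (he1 : e ≤ 1 / 2) (hβ0 : ∀ i, 0 ≤ β i)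
    (hβ : ∀ i, β i ≤ ν + 2 * e * (1 - ν)) (h₁ : ∑ i, β i ≤ 1)
    (h₂ : ∑ i, β i ^ 2 ≤ 2 * ν ^ 2 + 2 * e / ν) {k : ℕ} (hk : 2 ≤ k) :
    ∑ i, β i ^ k ≤ 2 * ν ^ k + 2 * e / ν := by
  have key (j m : ℕ) : ∑ i, β i ^ (j + m) ≤ (ν ^ j + 2 * e) * ∑ i, β i ^ m := by
    rw [mul_sum]
    refine sum_le_sum fun i _ => ?_
    rw [pow_add]
    refine mul_le_mul_of_nonneg_right ?_ (pow_nonneg (hβ0 i) _)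
    have hν := pow_nonneg hν0.le j
    calc β i ^ j ≤ (ν + 2 * e * (1 - ν)) ^ j := pow_le_pow_left₀ (hβ0 i) (hβ i) j
      _ ≤ ν ^ j + 2 * e * (1 - ν ^ j) :=
        pow_lineMap_one_le (by linarith) (by linarith) hν0.le j
      _ ≤ ν ^ j + 2 * e := by nlinarith
  obtain rfl | hk := hk.eq_or_lt
  · exact h₂
  obtain ⟨j, rfl⟩ : ∃ j, k = j + 3 := ⟨k - 3, by omega⟩
  have hνj0 : 0 < ν ^ j := pow_pos hν0 j
  have hνj1 : ν ^ j ≤ 1 := pow_le_one₀ hν0.le hν1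
  have hdiv : 2 * e / ν * ν = 2 * e := div_mul_cancel₀ _ hν0.ne'
  have hdiv0 : 2 * e ≤ 2 * e / ν := by
    rw [le_div_iff₀ hν0]; nlinarith
  by_cases hcase : 1 / 2 ≤ ν ∨ ν ^ 3 ≤ 2 * e
  · have h := key (j + 2) 1
    simp only [pow_one] at h
    have hp : 0 ≤ ν ^ (j + 2) + 2 * e := by positivity
    refine h.trans ((mul_le_of_le_one_right hp h₁).trans ?_)
    suffices (1 - 2 * ν) * ν ^ (j + 2) ≤ 2 * e / ν - 2 * e by
      rw [show ν ^ (j + 3) = ν * ν ^ (j + 2) by ring]; linarith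
    by_cases hν : 1 / 2 ≤ ν
    · have : 0 < ν ^ (j + 2) := by positivity
      nlinarith
    · have h3 := hcase.resolve_left hν
      push Not at hν
      have h2 : ν ^ 2 ≤ 2 * e / ν := by
        rw [le_div_iff₀ hν0]; linarith [pow_succ ν 2]
      calc (1 - 2 * ν) * ν ^ (j + 2) = (1 - 2 * ν) * (ν ^ j * ν ^ 2) := by ring
        _ ≤ (1 - 2 * ν) * (1 * (2 * e / ν)) := by
          gcongr
          linarith
        _ ≤ 2 * e / ν - 2 * e := by nlinarith
  · push Not at hcase
    obtain ⟨hν, h3⟩ := hcase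
    refine (key (j + 1) 2).trans ((mul_le_mul_of_nonneg_left h₂ (by positivity)).trans ?_)
    have hj : ν ^ (j + 1) ≤ 1 / 2 := by
      rw [pow_succ]; nlinarith
    have hν3 : ν ^ 3 ≤ 1 / 8 := by
      calc ν ^ 3 ≤ (1 / 2) ^ 3 := by gcongr
        _ = _ := by norm_num
    suffices 2 * e / ν * (ν ^ (j + 1) + 2 * ν ^ 3 + 2 * e) ≤ 2 * e / ν by
      calc _ = 2 * ν ^ (j + 3) + 2 * e / ν * (ν ^ (j + 1) + 2 * ν ^ 3 + 2 * e) := by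
            field_simp
            ring
        _ ≤ _ := by linarith
    exact mul_le_of_le_one_right (by positivity) (by linarith)

theorem sum_gram_nonneg {V : Type*} [Fintype V] {A : Matrix V V ℝ} (hA : A.IsSymm) :
    0 ≤ ∑ x, ∑ z, (A * A) x z := by
  have h : ∑ x, ∑ z, (A * A) x z = ∑ y, (∑ x, A x y) ^ 2 := by
    simp only [Matrix.mul_apply, sq, sum_mul_sum]
    rw [sum_comm_cycle]
    simp only [hA.apply]
  rw [h]
  positivity

theorem sum_gram_pow_three_nonneg {V : Type*} [Fintype V] {A : Matrix V V ℝ} (hA : A.IsSymm) :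
    0 ≤ ∑ x, ∑ z, (A * A) x z ^ 3 := by
  have h : ∑ x, ∑ z, (A * A) x z ^ 3 =
      ∑ a, ∑ b, ∑ c, (∑ x, A x a * A x b * A x c) ^ 2 := by
    have e (x z : V) : (A * A) x z ^ 3 = ∑ a, ∑ b, ∑ c,
        (A x a * A x b * A x c) * (A z a * A z b * A z c) := by
      rw [Matrix.mul_apply, pow_succ', sq, sum_mul_sum, sum_mul]
      simp only [mul_sum]
      refine sum_congr rfl fun a _ => sum_congr rfl fun b _ => sum_congr rfl fun c _ => ?_
      rw [hA.apply z a, hA.apply z b, hA.apply z c]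
      ring
    simp only [e, sq, sum_mul_sum]
    rw [sum_comm_cycle]
    refine sum_congr rfl fun a _ => ?_
    rw [sum_comm_cycle]
    refine sum_congr rfl fun b _ => ?_
    rw [sum_comm_cycle]
  rw [h]
  positivity

theorem eigenvalue_sq_mul_sum_posPart_sq_le {V : Type*} [Fintype V] {A : Matrix V V ℝ}
    (hA : A.IsSymm) {d o : ℝ} (hdiag : ∀ x, (A * A) x x ≤ d + o)
    (hd : 0 ≤ d) (ho : 0 ≤ o)
    (hoff : ∀ x z, x ≠ z → (A * A) x z ≤ o) {α : ℝ} {v : V → ℝ} (hv : A *ᵥ v = α • v) :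
    α ^ 2 * ∑ x, (v x)⁺ ^ 2 ≤ (d + o * #{x | 0 < v x}) * ∑ x, v x ^ 2 := by
  classical
  set p : V → ℝ := fun x => (v x)⁺ with hp
  set S := ∑ x, p x ^ 2 with hS
  have hp0 (x : V) : 0 ≤ p x := posPart_nonneg _
  have hpv : p ⬝ᵥ v = S := by
    refine sum_congr rfl fun x _ => ?_
    rcases le_total 0 (v x) with h | h
    · simp [hp, posPart_eq_self.2 h, sq]
    · simp [hp, posPart_eq_zero.2 h]
  have hS0 : 0 ≤ S := by positivity
  have hαS : α * S = (A *ᵥ p) ⬝ᵥ v := by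
    rw [← hpv, ← smul_eq_mul, ← dotProduct_smul, ← hv, dotProduct_mulVec, ← mulVec_transpose, hA]
  have hAp : (A *ᵥ p) ⬝ᵥ (A *ᵥ p) ≤ d * S + o * (∑ x, p x) ^ 2 := by
    have e : (A *ᵥ p) ⬝ᵥ (A *ᵥ p) = ∑ x, ∑ z, (A * A) x z * (p x * p z) := by
      rw [dotProduct_mulVec, ← mulVec_transpose, hA, mulVec_mulVec, dotProduct]
      refine sum_congr rfl fun x _ => ?_
      rw [mulVec, dotProduct, sum_mul]
      exact sum_congr rfl fun z _ => by ring
    have e' : d * S + o * (∑ x, p x) ^ 2 =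
        ∑ x, ∑ z, ((if x = z then d else 0) + o) * (p x * p z) := by
      simp only [add_mul, sum_add_distrib, ite_mul, zero_mul, sum_ite_eq, mem_univ, if_true,
        ← mul_sum, sq, sum_mul_sum, hS]
    rw [e, e']
    refine sum_le_sum fun x _ => sum_le_sum fun z _ => ?_
    refine mul_le_mul_of_nonneg_right ?_ (mul_nonneg (hp0 x) (hp0 z))
    split_ifs with h
    · exact h ▸ hdiag x
    · simpa using hoff x z h
  have hsum : (∑ x, p x) ^ 2 ≤ #{x | 0 < v x} * S := by
    have e : ∑ x, p x = ∑ x with 0 < v x, p x := by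
      refine (sum_filter_of_ne fun x _ hx => ?_).symm
      by_contra h
      exact hx (posPart_eq_zero.2 (not_lt.1 h))
    rw [e]
    refine sq_sum_le_card_mul_sum_sq.trans ?_
    exact mul_le_mul_of_nonneg_left (sum_le_univ_sum_of_nonneg fun _ => sq_nonneg _)
      (Nat.cast_nonneg _)
  have hcs : (α * S) ^ 2 ≤ (d + o * #{x | 0 < v x}) * S * ∑ x, v x ^ 2 := by
    rw [hαS]
    refine (sum_mul_sq_le_sq_mul_sq univ (A *ᵥ p) v).trans ?_
    gcongr
    have : ∑ x, (A *ᵥ p) x ^ 2 = (A *ᵥ p) ⬝ᵥ (A *ᵥ p) := by simp [dotProduct, sq]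
    rw [this]
    nlinarith
  rcases hS0.eq_or_lt with h | h
  · rw [← h, mul_zero]; positivity
  · refine le_of_mul_le_mul_right ?_ h
    linarith

theorem eigenvalue_sq_le {V : Type*} [Fintype V] {A : Matrix V V ℝ}
    (hA : A.IsSymm) {d o : ℝ} (hdiag : ∀ x, (A * A) x x ≤ d + o)
    (hd : 0 ≤ d) (ho : 0 ≤ o)
    (hoff : ∀ x z, x ≠ z → (A * A) x z ≤ o) {α : ℝ} {v : V → ℝ} (hv : A *ᵥ v = α • v)
    (hv0 : v ≠ 0) : α ^ 2 ≤ 2 * d + o * Fintype.card V := by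
  classical
  have hpos := eigenvalue_sq_mul_sum_posPart_sq_le hA hdiag hd ho hoff hv
  have hneg := eigenvalue_sq_mul_sum_posPart_sq_le hA hdiag hd ho hoff (v := -v)
    (by rw [mulVec_neg, hv, smul_neg])
  have hsplit : ∑ x, (v x)⁺ ^ 2 + ∑ x, ((-v) x)⁺ ^ 2 = ∑ x, v x ^ 2 := by
    rw [← sum_add_distrib]
    refine sum_congr rfl fun x _ => ?_
    rcases le_total 0 (v x) with h | h
    · simp [posPart_eq_self.2 h, negPart_eq_zero.2 h]
    · simp [posPart_eq_zero.2 h, negPart_eq_neg.2 h]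
  have hcard : (#{x | 0 < v x} + #{x | 0 < (-v) x} : ℝ) ≤ Fintype.card V := by
    rw [← Nat.cast_add, ← card_union_of_disjoint]
    · exact_mod_cast card_le_univ _
    · rw [disjoint_filter]
      intro x _ h
      simpa using h.le
  have hvpos : 0 < ∑ x, v x ^ 2 := by
    obtain ⟨x, hx⟩ := Function.ne_iff.1 hv0
    exact sum_pos' (fun _ _ => sq_nonneg _) ⟨x, mem_univ x, sq_pos_of_ne_zero hx⟩
  refine le_of_mul_le_mul_right ?_ hvpos
  simp only [Pi.neg_apply, neg_sq] at hneg hsplit hcard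
  calc α ^ 2 * ∑ x, v x ^ 2 ≤
      (2 * d + o * (#{x | 0 < v x} + #{x | 0 < -v x})) * ∑ x, v x ^ 2 := by
        rw [← hsplit] at hpos hneg ⊢
        linarith
    _ ≤ _ := by gcongr

/-- With `t = (A * A) x z`, bound `t ^ 2 + ν * n / 2 * t + t ^ 3 / (2 * (ν * n))` pointwise and use that the sums
of `t` and `t ^ 3` over all `x`, `z` are nonnegative. -/
theorem trace_pow_four_le {V : Type*} [Fintype V] [DecidableEq V] {A : Matrix V V ℝ}
    (hA : A.IsSymm) {ν n : ℝ} (hn : Fintype.card V = n) (hn0 : 0 < n) (hν0 : 0 < ν) (hν1 : ν ≤ 1)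
    (hdiag0 : ∀ x, 0 ≤ (A * A) x x) (hdiag : ∀ x, (A * A) x x ≤ n)
    (hoff : ∀ x z, x ≠ z → (A * A) x z ≤ ν * n) :
    (A ^ 4).trace ≤ 2 * ν ^ 2 * n ^ 4 + 2 / ν * n ^ 3 := by
  have hνn : 0 < ν * n := mul_pos hν0 hn0
  have hpt (x z : V) : (A * A) x z ^ 2 ≤ (if x = z then 2 / ν * n ^ 2 else 0) +
      2 * (ν * n) ^ 2 - (ν * n / 2 * (A * A) x z + (A * A) x z ^ 3 / (2 * (ν * n))) := by
    set t := (A * A) x z with ht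
    have e : t ^ 2 + (ν * n / 2 * t + t ^ 3 / (2 * (ν * n))) =
        t * (t + ν * n) ^ 2 / (2 * (ν * n)) := by
      field_simp
      ring
    suffices t * (t + ν * n) ^ 2 / (2 * (ν * n)) ≤
        (if x = z then 2 / ν * n ^ 2 else 0) + 2 * (ν * n) ^ 2 by linarith
    split_ifs with h
    · subst h
      have h0 : 0 ≤ t := hdiag0 x
      calc t * (t + ν * n) ^ 2 / (2 * (ν * n)) ≤ n * (n + 1 * n) ^ 2 / (2 * (ν * n)) := by
            gcongr <;> exact hdiag x
        _ = 2 / ν * n ^ 2 := by field_simp; ring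
        _ ≤ _ := le_add_of_nonneg_right (by positivity)
    · rw [zero_add, div_le_iff₀ (by positivity)]
      have hto : t ≤ ν * n := hoff x z h
      rcases le_total 0 t with h0 | h0
      · calc t * (t + ν * n) ^ 2 ≤ ν * n * (ν * n + ν * n) ^ 2 := by gcongr
          _ = _ := by ring
      · exact (mul_nonpos_of_nonpos_of_nonneg h0 (sq_nonneg _)).trans (by positivity)
  have htr : (A ^ 4).trace = ∑ x, ∑ z, (A * A) x z ^ 2 := by
    rw [show A ^ 4 = (A * A) * (A * A) by simp only [pow_succ, pow_zero, one_mul, mul_assoc],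
      trace]
    refine sum_congr rfl fun x _ => ?_
    rw [diag_apply, Matrix.mul_apply]
    refine sum_congr rfl fun z _ => ?_
    have hs : (A * A).IsSymm := by rw [IsSymm, transpose_mul, hA]
    rw [hs.apply x z, sq]
  rw [htr]
  refine (sum_le_sum fun x _ => sum_le_sum fun z _ => hpt x z).trans ?_
  simp only [sum_sub_distrib, sum_add_distrib, sum_ite_eq, mem_univ, if_true, sum_const, card_univ,
    nsmul_eq_mul, hn, ← mul_sum, ← sum_div]
  have h1 : 0 ≤ ν * n / 2 * ∑ x, ∑ z, (A * A) x z := mul_nonneg (by positivity) (sum_gram_nonneg hA)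
  have h3 : 0 ≤ (∑ x, ∑ z, (A * A) x z ^ 3) / (2 * (ν * n)) :=
    div_nonneg (sum_gram_pow_three_nonneg hA) (by positivity)
  linarith

theorem abs_trace_pow_three_le {V : Type*} [Fintype V] [DecidableEq V] {A : Matrix V V ℝ}
    (hA : A.IsSymm) (hbd : ∀ x y, |A x y| ≤ 1) {ν n : ℝ} (hn : Fintype.card V = n)
    (hn0 : 0 ≤ n) (hν0 : 0 ≤ ν) (hdiag : ∀ x, (A * A) x x ≤ n)
    (hoff : ∀ x z, x ≠ z → (A * A) x z ≤ ν * n) :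
    |(A ^ 3).trace| ≤ 2 * ν * n ^ 3 + 2 * n ^ 2 := by
  have hνn : 0 ≤ ν * n := mul_nonneg hν0 hn0
  have hpt (x z : V) : |(A * A) x z * A z x| ≤
      (if x = z then 2 * n else 0) + 2 * (ν * n) - (A * A) x z := by
    rw [abs_mul]
    refine (mul_le_of_le_one_right (abs_nonneg _) (hbd z x)).trans ?_
    split_ifs with h
    · subst h
      exact abs_le.2 ⟨by linarith [hdiag x], by linarith [hdiag x]⟩
    · exact abs_le.2 ⟨by linarith [hoff x z h], by linarith [hoff x z h]⟩
  have htr : (A ^ 3).trace = ∑ x, ∑ z, (A * A) x z * A z x := by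
    rw [pow_succ, sq, trace]
    exact sum_congr rfl fun x _ => Matrix.mul_apply
  rw [htr]
  refine (abs_sum_le_sum_abs _ _).trans <|
    (sum_le_sum fun x _ => abs_sum_le_sum_abs _ _).trans <|
    (sum_le_sum fun x _ => sum_le_sum fun z _ => hpt x z).trans ?_
  simp only [sum_sub_distrib, sum_add_distrib, sum_ite_eq, mem_univ, if_true, sum_const, card_univ,
    nsmul_eq_mul, hn]
  linarith [sum_gram_nonneg hA]

theorem abs_trace_pow_le {V : Type*} [Fintype V] [DecidableEq V] {A : Matrix V V ℝ}
    (hA : A.IsSymm) (hbd : ∀ x y, |A x y| ≤ 1) {ν n : ℝ} (hn : Fintype.card V = n)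
    (hn2 : 2 ≤ n) (hν0 : 0 < ν) (hν1 : ν ≤ 1)
    (hoff : ∀ x z, x ≠ z → (A * A) x z ≤ ν * n) {l : ℕ} (hl : 3 ≤ l) :
    |(A ^ l).trace| ≤ 2 * ν ^ (l / 2) * n ^ l + 2 / ν * n ^ (l - 1) := by
  have hn0 : 0 < n := by linarith
  have hdiag0 (x : V) : 0 ≤ (A * A) x x := by
    rw [Matrix.mul_apply]
    exact sum_nonneg fun y _ => by rw [hA.apply x y]; exact mul_self_nonneg _
  have hdiag (x : V) : (A * A) x x ≤ n := by
    rw [Matrix.mul_apply, ← hn, ← nsmul_one, ← card_univ]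
    refine sum_le_card_nsmul _ _ _ fun y _ => (le_abs_self _).trans ?_
    rw [abs_mul]
    exact mul_le_one₀ (hbd x y) (abs_nonneg _) (hbd y x)
  obtain rfl | hl := hl.eq_or_lt
  · refine (abs_trace_pow_three_le hA hbd hn hn0.le hν0.le hdiag hoff).trans ?_
    have : 2 ≤ 2 / ν := by rw [le_div_iff₀ hν0]; linarith
    norm_num
    gcongr
  have hH : A.IsHermitian := by rwa [IsHermitian, conjTranspose_eq_transpose_of_trivial]
  set α := hH.eigenvalues with hα
  have hαsq (i : V) : (α i / n) ^ 2 ≤ ν + 2 * (1 / n) * (1 - ν) := by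
    have h := eigenvalue_sq_le hA (d := (1 - ν) * n) (o := ν * n)
      (fun x => by linarith [hdiag x]) (mul_nonneg (by linarith) hn0.le) (by positivity) hoff
      (hH.mulVec_eigenvectorBasis i)
      (by
        have := hH.eigenvectorBasis.orthonormal.ne_zero i
        simpa using this)
    rw [hn] at h
    rw [div_pow, div_le_iff₀ (by positivity)]
    calc α i ^ 2 ≤ _ := h
      _ = _ := by field_simp; ring
  have h₁ : ∑ i, (α i / n) ^ 2 ≤ 1 := by
    simp only [div_pow, ← sum_div]
    rw [← trace_pow_eq_sum_eigenvalues_pow hH 2, div_le_one (by positivity), sq, sq, trace]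
    refine (sum_le_card_nsmul _ _ _ fun x _ => hdiag x).trans_eq ?_
    rw [card_univ, nsmul_eq_mul, hn]
  have h₂ : ∑ i, ((α i / n) ^ 2) ^ 2 ≤ 2 * ν ^ 2 + 2 * (1 / n) / ν := by
    simp only [← pow_mul, div_pow, ← sum_div]
    rw [← trace_pow_eq_sum_eigenvalues_pow hH 4, div_le_iff₀ (by positivity)]
    refine (trace_pow_four_le hA hn hn0 hν0 hν1 hdiag0 hdiag hoff).trans_eq ?_
    field_simp
  have hk := sum_pow_le hν0 hν1 (one_div_pos.2 hn0) (one_div_le_one_div_of_le two_pos hn2)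
    (fun i => sq_nonneg (α i / n)) hαsq h₁ h₂ (k := l / 2) (by omega)
  have hα1 (i : V) : |α i / n| ≤ 1 := by
    rw [← sq_le_one_iff_abs_le_one]
    exact (single_le_sum (f := fun i => (α i / n) ^ 2) (fun i _ => sq_nonneg _)
      (mem_univ i)).trans h₁
  have hpow (i : V) : |α i ^ l| ≤ n ^ l * ((α i / n) ^ 2) ^ (l / 2) := by
    rw [← sq_abs, ← pow_mul]
    calc |α i ^ l| = n ^ l * |α i / n| ^ l := by
          rw [← abs_pow, div_pow, abs_div, abs_of_pos (pow_pos hn0 l)]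
          field_simp
      _ ≤ _ := by
        gcongr ?_ * ?_
        exact pow_le_pow_of_le_one (abs_nonneg _) (hα1 i) (by omega)
  rw [trace_pow_eq_sum_eigenvalues_pow hH l]
  calc |∑ i, α i ^ l| ≤ ∑ i, n ^ l * ((α i / n) ^ 2) ^ (l / 2) :=
        (abs_sum_le_sum_abs _ _).trans (sum_le_sum fun i _ => hpow i)
    _ ≤ n ^ l * (2 * ν ^ (l / 2) + 2 * (1 / n) / ν) := by
      rw [← mul_sum]
      gcongr
    _ = _ := by
      obtain ⟨m, rfl⟩ : ∃ m, l = m + 1 := ⟨l - 1, by omega⟩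
      rw [Nat.add_sub_cancel, pow_succ]
      field_simp

theorem stmt7 (V : Type*) [Fintype V] (n : ℕ) (hn : Fintype.card V = n)
    (g : V → V → ℝ) (hsymm : ∀ x y, g x y = g y x) (hbd : ∀ x y, |g x y| ≤ 1)
    (μ ν : ℝ) (hμ : 0 ≤ μ) (hν0 : 0 < ν) (hν1 : ν ≤ 1)
    (hdeg : ∀ x : V, |∑ y : V, g x y| ≤ μ * n)
    (hquasi : ∀ x z : V, x ≠ z → ∑ y : V, g x y * g y z ≤ ν * n)
    (l : ℕ) (hl : 3 ≤ l) :
    |∑ y : Fin l → V, ∏ i : Fin l, g (y i) (y (finRotate l i))| ≤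
      2 * ν ^ (l / 2) * (n : ℝ) ^ l + 2 / ν * (n : ℝ) ^ (l - 1) := by
  classical
  have hn' : (Fintype.card V : ℝ) = n := by exact_mod_cast hn
  rcases le_or_gt 2 n with hn2 | hn2
  · have h := abs_trace_pow_le (A := Matrix.of g) (Matrix.IsSymm.ext fun x y => hsymm y x) hbd hn'
      (by exact_mod_cast hn2) hν0 hν1 (fun x z hxz => by
        rw [Matrix.mul_apply]
        exact hquasi x z hxz) hl
    rwa [← sum_prod_finRotate_eq_trace_pow _ (by omega)] at h
  · have hcard : |∑ y : Fin l → V, ∏ i : Fin l, g (y i) (y (finRotate l i))| ≤ (n : ℝ) ^ l := by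
      refine (abs_sum_le_sum_abs _ _).trans <| (sum_le_card_nsmul _ _ 1 fun y _ => ?_).trans_eq ?_
      · rw [abs_prod]
        exact prod_le_one (fun _ _ => abs_nonneg _) fun _ _ => hbd _ _
      · simp [hn]
    have hn1 : (n : ℝ) ≤ 2 / ν := by
      rw [le_div_iff₀ hν0]
      have : (n : ℝ) ≤ 1 := by exact_mod_cast Nat.lt_succ_iff.1 hn2
      nlinarith
    calc _ ≤ (n : ℝ) ^ l := hcard
      _ = n * (n : ℝ) ^ (l - 1) := by rw [← pow_succ', Nat.sub_add_cancel (by omega)]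
      _ ≤ 2 / ν * (n : ℝ) ^ (l - 1) := by gcongr
      _ ≤ _ := le_add_of_nonneg_left (by positivity)
end

section
/- Let V be a finite set of size n and g : V × V → ℝ symmetric with |g| ≤ 1, |Σ_y g(x,y)| ≤ μ·n for all x, and Σ_y g(x,y)·g(y,z) ≤ ν·n for all x ≠ z, with 0 < ν ≤ 1. Then for every integer l ≥ 3, the path sum satisfies |Σ_{x_1,...,x_l} g(x_1,x_2)·g(x_2,x_3)···g(x_{l-1},x_l)| ≤ 2·μ^{l+1-2⌊l/2⌋}·ν^{⌊l/2⌋-1}·n^l + (2·μ^{l+1-2⌊l/2⌋}/ν³)·n^{l-1}. -/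
/-- The operator `f ↦ (x ↦ ∑ y, g x y * f y)` with kernel `g`. -/
noncomputable def kernelOp {V : Type*} [Fintype V] (g : V → V → ℝ) (f : V → ℝ) : V → ℝ :=
  fun x => ∑ y, g x y * f y

/-- For a symmetric kernel, path sums are sums of iterates of the kernel operator. -/
lemma sum_path_eq_sum_iterate {V : Type*} [Fintype V] (g : V → V → ℝ)
    (hsymm : ∀ x y, g x y = g y x) (k : ℕ) (f : V → ℝ) :
    ∑ x : Fin (k + 1) → V, f (x 0) * ∏ i : Fin k, g (x i.castSucc) (x i.succ) =
      ∑ x, ((kernelOp g)^[k] f) x := by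
  induction k generalizing f with
  | zero =>
    rw [← (Equiv.funUnique (Fin 1) V).sum_comp]
    simp
  | succ k ih =>
    rw [Function.iterate_succ_apply, ← ih, ← (Fin.consEquiv fun _ => V).sum_comp,
      Fintype.sum_prod_type_right]
    refine Finset.sum_congr rfl fun x _ => ?_
    simp only [kernelOp, Finset.sum_mul]
    refine Finset.sum_congr rfl fun y _ => ?_
    rw [Fin.prod_univ_succ]
    simp only [Fin.consEquiv_apply, Fin.cons_zero, Fin.cons_succ, Fin.castSucc_zero,
      Fin.castSucc_succ]
    rw [hsymm y (x 0)]
    ring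

lemma sum_kernelOp_mul {V : Type*} [Fintype V] (g : V → V → ℝ)
    (hsymm : ∀ x y, g x y = g y x) (f : V → ℝ) :
    ∑ x, kernelOp g f x = ∑ x, (∑ y, g x y) * f x := by
  simp only [kernelOp, Finset.sum_mul]
  rw [Finset.sum_comm]
  exact Finset.sum_congr rfl fun x _ => Finset.sum_congr rfl fun y _ => by rw [hsymm]

lemma sum_sq_iterate_kernelOp_le {V : Type*} [Fintype V] (g : V → V → ℝ) (C : ℝ) (hC : 0 ≤ C)
    (h : ∀ f : V → ℝ, ∑ x, kernelOp g f x ^ 2 ≤ C * ∑ x, f x ^ 2) (k : ℕ) (f : V → ℝ) :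
    ∑ x, ((kernelOp g)^[k] f) x ^ 2 ≤ C ^ k * ∑ x, f x ^ 2 := by
  induction k with
  | zero => simp
  | succ k ih =>
    rw [Function.iterate_succ_apply', pow_succ', mul_assoc]
    exact (h _).trans (mul_le_mul_of_nonneg_left ih hC)

/-- The quadratic form of `gᵀ g` on nonnegative vectors, when the off-diagonal entries of `gᵀ g`
are bounded above by `a` and the diagonal ones by `a + b`. -/
lemma sum_sq_sum_le_of_nonneg {V : Type*} [Fintype V] (g : V → V → ℝ) (a b : ℝ) (ha : 0 ≤ a)
    (hoff : ∀ x z, x ≠ z → ∑ y, g y x * g y z ≤ a) (hdiag : ∀ x, ∑ y, g y x * g y x ≤ a + b)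
    (S : Finset V) (w : V → ℝ) (hw : ∀ x ∈ S, 0 ≤ w x) :
    ∑ y, (∑ x ∈ S, g y x * w x) ^ 2 ≤ (a * S.card + b) * ∑ x ∈ S, w x ^ 2 := by
  classical
  have hexp : ∑ y, (∑ x ∈ S, g y x * w x) ^ 2 =
      ∑ x ∈ S, ∑ z ∈ S, w x * w z * ∑ y, g y x * g y z := by
    simp only [sq, Finset.mul_sum, Finset.sum_mul]
    rw [Finset.sum_comm]
    refine Finset.sum_congr rfl fun x _ => ?_
    rw [Finset.sum_comm]
    exact Finset.sum_congr rfl fun z _ => Finset.sum_congr rfl fun y _ => by ring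
  have hent : ∑ x ∈ S, ∑ z ∈ S, w x * w z * ∑ y, g y x * g y z ≤
      ∑ x ∈ S, ∑ z ∈ S, w x * w z * (a + if x = z then b else 0) := by
    refine Finset.sum_le_sum fun x hx => Finset.sum_le_sum fun z hz =>
      mul_le_mul_of_nonneg_left ?_ (mul_nonneg (hw x hx) (hw z hz))
    split_ifs with hxz
    · subst hxz
      exact hdiag x
    · simpa using hoff x z hxz
  have hval : ∑ x ∈ S, ∑ z ∈ S, w x * w z * (a + if x = z then b else 0) =
      a * (∑ x ∈ S, w x) ^ 2 + b * ∑ x ∈ S, w x ^ 2 := by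
    simp only [mul_add, Finset.sum_add_distrib, mul_ite, mul_zero, Finset.sum_ite_eq]
    congr 1
    · rw [sq, Finset.sum_mul_sum, Finset.mul_sum]
      refine Finset.sum_congr rfl fun x _ => ?_
      rw [Finset.mul_sum]
      exact Finset.sum_congr rfl fun z _ => by ring
    · rw [Finset.mul_sum]
      refine Finset.sum_congr rfl fun x hx => ?_
      rw [if_pos hx]
      ring
  have hcs := mul_le_mul_of_nonneg_left (sq_sum_le_card_mul_sum_sq (s := S) (f := w)) ha
  rw [hexp]
  linarith

/-- One-sided bounds on the entries of `gᵀ g` control the operator norm of `g`. -/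
lemma sum_sq_kernelOp_le {V : Type*} [Fintype V] (g : V → V → ℝ) (a b : ℝ)
    (ha : 0 ≤ a) (hb : 0 ≤ b)
    (hoff : ∀ x z, x ≠ z → ∑ y, g y x * g y z ≤ a) (hdiag : ∀ x, ∑ y, g y x * g y x ≤ a + b)
    (f : V → ℝ) :
    ∑ x, kernelOp g f x ^ 2 ≤ (a * Fintype.card V + 2 * b) * ∑ x, f x ^ 2 := by
  classical
  set S : Finset V := Finset.univ.filter fun x => 0 ≤ f x with hS
  have hpos := sum_sq_sum_le_of_nonneg g a b ha hoff hdiag S f fun x hx => by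
    simpa [hS] using hx
  have hneg := sum_sq_sum_le_of_nonneg g a b ha hoff hdiag Sᶜ (fun x => -f x) fun x hx => by
    have : f x < 0 := by simpa [hS] using hx
    linarith
  simp only [neg_sq] at hneg
  set p : V → ℝ := fun y => ∑ x ∈ S, g y x * f x with hp
  set q : V → ℝ := fun y => ∑ x ∈ Sᶜ, g y x * -f x with hq
  have hsplit : ∀ y, kernelOp g f y = p y - q y := fun y => by
    simp only [kernelOp, hp, hq, mul_neg, Finset.sum_neg_distrib, sub_neg_eq_add]
    exact (Finset.sum_add_sum_compl S _).symm
  have hsq : ∑ x, kernelOp g f x ^ 2 =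
      ∑ x, p x ^ 2 - 2 * ∑ x, p x * q x + ∑ x, q x ^ 2 := by
    rw [Finset.mul_sum, ← Finset.sum_sub_distrib, ← Finset.sum_add_distrib]
    exact Finset.sum_congr rfl fun x _ => by rw [hsplit]; ring
  have hcard : (S.card : ℝ) + (Sᶜ.card : ℝ) = Fintype.card V := by
    exact_mod_cast Finset.card_add_card_compl S
  have hnorm : ∑ x ∈ S, f x ^ 2 + ∑ x ∈ Sᶜ, f x ^ 2 = ∑ x, f x ^ 2 :=
    Finset.sum_add_sum_compl S _
  have hcs : (∑ x, p x * q x) ^ 2 ≤ (∑ x, p x ^ 2) * ∑ x, q x ^ 2 :=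
    Finset.sum_mul_sq_le_sq_mul_sq _ _ _
  have hA : 0 ≤ ∑ x ∈ S, f x ^ 2 := Finset.sum_nonneg fun _ _ => sq_nonneg _
  have hB : 0 ≤ ∑ x ∈ Sᶜ, f x ^ 2 := Finset.sum_nonneg fun _ _ => sq_nonneg _
  have hQ : 0 ≤ ∑ x, q x ^ 2 := Finset.sum_nonneg fun _ _ => sq_nonneg _
  rw [hsq, ← hnorm, ← hcard]
  set A := ∑ x ∈ S, f x ^ 2
  set B := ∑ x ∈ Sᶜ, f x ^ 2
  set c₁ : ℝ := a * S.card + b with hc₁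
  set c₂ : ℝ := a * (Sᶜ.card : ℝ) + b with hc₂
  have hc₁0 : 0 ≤ c₁ := by positivity
  have hc₂0 : 0 ≤ c₂ := by positivity
  have hcross : |2 * ∑ x, p x * q x| ≤ c₁ * B + c₂ * A := by
    refine abs_le_of_sq_le_sq ?_ (by positivity)
    have := hcs.trans (mul_le_mul hpos hneg hQ (by positivity))
    nlinarith [sq_nonneg (c₁ * B - c₂ * A)]
  have := neg_le_of_abs_le hcross
  have hsum : (a * ((S.card : ℝ) + (Sᶜ.card : ℝ)) + 2 * b) = c₁ + c₂ := by
    rw [hc₁, hc₂]; ring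
  rw [hsum]
  nlinarith

/-- The trivial bound on the operator norm of a kernel with entries in `[-1, 1]`. -/
lemma sum_sq_kernelOp_le_card_sq {V : Type*} [Fintype V] (g : V → V → ℝ)
    (hbd : ∀ x y, |g x y| ≤ 1) (f : V → ℝ) :
    ∑ x, kernelOp g f x ^ 2 ≤ (Fintype.card V : ℝ) ^ 2 * ∑ x, f x ^ 2 := by
  have hF : 0 ≤ ∑ x, f x ^ 2 := Finset.sum_nonneg fun _ _ => sq_nonneg _
  have hx : ∀ x, kernelOp g f x ^ 2 ≤ Fintype.card V * ∑ y, f y ^ 2 := fun x => by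
    have hrow : ∑ y, g x y ^ 2 ≤ Fintype.card V := by
      simpa using Finset.sum_le_card_nsmul Finset.univ (fun y => g x y ^ 2) 1 fun y _ =>
        (sq_le_one_iff_abs_le_one _).2 (hbd x y)
    exact (Finset.sum_mul_sq_le_sq_mul_sq _ _ _).trans (mul_le_mul_of_nonneg_right hrow hF)
  have := Finset.sum_le_card_nsmul Finset.univ _ _ fun x _ => hx x
  rw [Finset.card_univ, nsmul_eq_mul] at this
  linarith

lemma two_mul_mul_le_one_add_pow {x : ℝ} (hx : 0 ≤ x) {m : ℕ} (hm : 2 ≤ m) :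
    2 * (m * x) ≤ (1 + x) ^ m := by
  have hm' : (1 : ℝ) ≤ m / 2 := by
    have : (2 : ℝ) ≤ m := by exact_mod_cast hm
    linarith
  have hbern := one_add_mul_self_le_rpow_one_add (by linarith : (-1 : ℝ) ≤ x) hm'
  have hpow : ((1 + x) ^ ((m : ℝ) / 2)) ^ 2 = (1 + x) ^ m := by
    rw [← Real.rpow_natCast, ← Real.rpow_mul (by linarith), ← Real.rpow_natCast]
    congr 1
    push_cast
    ring
  rw [← hpow]
  have h0 : 0 ≤ (m : ℝ) / 2 * x := by positivity
  nlinarith [sq_nonneg ((m : ℝ) / 2 * x - 1)]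

lemma two_mul_mul_pow_mul_one_sub_le_one {r : ℝ} (hr0 : 0 < r) (hr1 : r ≤ 1) {m : ℕ}
    (hm : 2 ≤ m) : 2 * (m * r ^ (m - 1) * (1 - r)) ≤ 1 := by
  have h := two_mul_mul_le_one_add_pow (x := (1 - r) / r)
    (div_nonneg (by linarith) hr0.le) hm
  have hx : 1 + (1 - r) / r = r⁻¹ := by field_simp; ring
  rw [hx] at h
  have hmul := mul_le_mul_of_nonneg_right h (pow_pos hr0 m).le
  rw [← mul_pow, inv_mul_cancel₀ hr0.ne', one_pow] at hmul
  have hpow : r ^ m = r ^ (m - 1) * r := by rw [← pow_succ]; congr 1; omega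
  refine le_of_eq_of_le ?_ hmul
  rw [hpow]
  field_simp

/-- The numerical estimate absorbing the powers of the operator norm. -/
lemma mul_pow_le_of_four_le {n ν : ℝ} (hn : 4 ≤ n) (hν0 : 0 < ν) (hν1 : ν ≤ 1) (m : ℕ) :
    n * (ν + 2 * (1 - ν) / n) ^ m ≤ 2 * n * ν ^ m + 2 := by
  have hn0 : 0 < n := by linarith
  set r := ν + 2 * (1 - ν) / n with hr
  have hnr : n * (r - ν) = 2 * (1 - ν) := by rw [hr]; field_simp; ring
  have hνr : ν ≤ r := by
    have : 0 ≤ 2 * (1 - ν) / n := div_nonneg (by linarith) hn0.le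
    linarith
  have hr1 : r ≤ 1 := by nlinarith
  have hνm : 0 < ν ^ m := pow_pos hν0 m
  have hgap : 1 - ν ≤ 2 * (1 - r) := by nlinarith
  rcases Nat.lt_or_ge m 2 with hm | hm
  · interval_cases m
    · simp; linarith
    · simp only [pow_one]; nlinarith
  · have hdiff : r ^ m - ν ^ m ≤ (r - ν) * (m * r ^ (m - 1)) := by
      have hgeom := (Commute.all r ν).mul_geom_sum₂ m
      rw [← hgeom]
      refine mul_le_mul_of_nonneg_left ?_ (by linarith)
      have := Finset.sum_le_card_nsmul (Finset.range m)
        (fun i => r ^ i * ν ^ (m - 1 - i)) (r ^ (m - 1)) fun i hi => by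
          have hi' := Finset.mem_range.1 hi
          calc r ^ i * ν ^ (m - 1 - i) ≤ r ^ i * r ^ (m - 1 - i) := by gcongr
            _ = r ^ (m - 1) := by rw [← pow_add]; congr 1; omega
      simpa using this
    have hmax := two_mul_mul_pow_mul_one_sub_le_one (hν0.trans_le hνr) hr1 hm
    have hR : 0 ≤ m * r ^ (m - 1) := by have := hν0.trans_le hνr; positivity
    have h1 := mul_le_mul_of_nonneg_left hdiff hn0.le
    have h2 : n * ((r - ν) * (m * r ^ (m - 1))) = 2 * (1 - ν) * (m * r ^ (m - 1)) := by
      rw [← mul_assoc, hnr]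
    nlinarith [mul_le_mul_of_nonneg_right hgap hR]

lemma three_mul_pow_le {ν : ℝ} (hν0 : 0 < ν) (hν1 : ν ≤ 1) (m : ℕ) :
    3 * (ν + 2 * (1 - ν) / 3) ^ m ≤ 2 * 3 * ν ^ m + 2 / ν ^ 3 := by
  set r := ν + 2 * (1 - ν) / 3 with hr
  have hr0 : 0 < r := by linarith
  have hr1 : r ≤ 1 := by linarith
  have hνm : 0 < ν ^ m := pow_pos hν0 m
  have ht1 : r ^ m ≤ 1 := pow_le_one₀ hr0.le hr1
  rcases le_total ν (4 / 5) with h | h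
  · have h3 : ν ^ 3 ≤ (4 / 5) ^ 3 := by gcongr
    have : 3 ≤ 2 / ν ^ 3 := by
      rw [le_div_iff₀ (by positivity)]
      linarith
    linarith
  · have h2 : 2 ≤ 2 / ν ^ 3 := by
      rw [le_div_iff₀ (by positivity)]
      have := pow_le_one₀ (n := 3) hν0.le hν1
      linarith
    have hr4 : r ^ 4 ≤ ν := by
      have hνr : ν = 3 * r - 2 := by rw [hr]; ring
      have hr' : 14 / 15 ≤ r := by linarith
      have hfac : 0 ≤ r ^ 3 + r ^ 2 + r - 2 := by nlinarith [sq_nonneg r, pow_pos hr0 3]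
      rw [hνr]
      nlinarith [mul_nonneg (sub_nonneg.2 hr1) hfac]
    have hpow : (r ^ m) ^ 4 ≤ ν ^ m := by
      rw [← pow_mul, mul_comm, pow_mul]
      gcongr
    nlinarith [sq_nonneg ((r ^ m) ^ 2 - 1 / 4), sq_nonneg (r ^ m - 1 / 2)]

/-- An operator norm bound for quasirandom kernels whose powers are under control. -/
lemma exists_sum_sq_kernelOp_le {V : Type*} [Fintype V] [Nonempty V] (g : V → V → ℝ)
    (hsymm : ∀ x y, g x y = g y x) (hbd : ∀ x y, |g x y| ≤ 1) (ν : ℝ) (hν0 : 0 < ν) (hν1 : ν ≤ 1)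
    (hquasi : ∀ x z : V, x ≠ z → ∑ y : V, g x y * g y z ≤ ν * Fintype.card V) :
    ∃ ρ : ℝ, 0 ≤ ρ ∧
      (∀ f : V → ℝ, ∑ x, kernelOp g f x ^ 2 ≤ ρ * (Fintype.card V : ℝ) ^ 2 * ∑ x, f x ^ 2) ∧
      ∀ m : ℕ, Fintype.card V * ρ ^ m ≤ 2 * Fintype.card V * ν ^ m + 2 / ν ^ 3 := by
  have h2 : 2 ≤ 2 / ν ^ 3 := by
    rw [le_div_iff₀ (by positivity)]
    have := pow_le_one₀ (n := 3) hν0.le hν1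
    linarith
  have hn0 : (0 : ℝ) < Fintype.card V := by exact_mod_cast Fintype.card_pos
  rcases Nat.lt_or_ge (Fintype.card V) 3 with hn | hn
  · refine ⟨1, zero_le_one, fun f => ?_, fun m => ?_⟩
    · simpa using sum_sq_kernelOp_le_card_sq g hbd f
    · have : (Fintype.card V : ℝ) ≤ 2 := by exact_mod_cast Nat.le_of_lt_succ hn
      have hνm : 0 < Fintype.card V * ν ^ m := by positivity
      rw [one_pow]
      linarith
  · refine ⟨ν + 2 * (1 - ν) / Fintype.card V,
      add_nonneg hν0.le (div_nonneg (by linarith) hn0.le), fun f => ?_, fun m => ?_⟩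
    · have := sum_sq_kernelOp_le g (ν * Fintype.card V) ((1 - ν) * Fintype.card V)
        (by positivity) (mul_nonneg (by linarith) hn0.le)
        (fun x z hxz => by simpa only [hsymm x] using hquasi x z hxz)
        (fun x => by
          have := Finset.sum_le_card_nsmul Finset.univ (fun y => g y x * g y x) 1 fun y _ => by
            rw [← sq]
            exact (sq_le_one_iff_abs_le_one _).2 (hbd y x)
          rw [Finset.card_univ, nsmul_eq_mul] at this
          linarith) f
      convert this using 2
      field_simp
    · rcases Nat.lt_or_ge (Fintype.card V) 4 with hn4 | hn4
      · have h3 : Fintype.card V = 3 := by omega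
        rw [h3]
        exact_mod_cast three_mul_pow_le hν0 hν1 m
      · exact (mul_pow_le_of_four_le (by exact_mod_cast hn4) hν0 hν1 m).trans (by linarith)

/-- The bound on the sum of an odd iterate of the kernel operator, applied to `f`. -/
lemma abs_sum_iterate_kernelOp_le {V : Type*} [Fintype V] (g : V → V → ℝ)
    (hsymm : ∀ x y, g x y = g y x) (μ ρ : ℝ) (hμ : 0 ≤ μ) (hρ : 0 ≤ ρ)
    (hdeg : ∀ x : V, |∑ y : V, g x y| ≤ μ * Fintype.card V)
    (hop : ∀ f : V → ℝ, ∑ x, kernelOp g f x ^ 2 ≤ ρ * (Fintype.card V : ℝ) ^ 2 * ∑ x, f x ^ 2)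
    (m : ℕ) (f : V → ℝ) (c : ℝ) (hc : 0 ≤ c) (hf : ∀ x, |f x| ≤ c) :
    |∑ x, ((kernelOp g)^[2 * m + 1] f) x| ≤
      μ * c * (Fintype.card V : ℝ) ^ (2 * m + 2) * ρ ^ m := by
  have hsq : ∀ (h : V → ℝ) (b : ℝ), 0 ≤ b → (∀ x, |h x| ≤ b) →
      ∑ x, h x ^ 2 ≤ Fintype.card V * b ^ 2 := fun h b hb hh => by
    simpa using Finset.sum_le_card_nsmul Finset.univ (fun x => h x ^ 2) (b ^ 2) fun x _ =>
      sq_le_sq' (neg_le_of_abs_le (hh x)) (le_of_abs_le (hh x))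
  rw [Function.iterate_succ_apply', sum_kernelOp_mul g hsymm]
  refine abs_le_of_sq_le_sq ?_ (by positivity)
  refine (Finset.sum_mul_sq_le_sq_mul_sq _ _ _).trans ?_
  have hit := (sum_sq_iterate_kernelOp_le g _ (by positivity) hop (2 * m) f).trans
    (mul_le_mul_of_nonneg_left (hsq f c hc hf) (by positivity))
  refine (mul_le_mul (hsq _ _ (by positivity) hdeg) hit
    (Finset.sum_nonneg fun _ _ => sq_nonneg _) (by positivity)).trans (le_of_eq ?_)
  ring

theorem stmt8 (V : Type*) [Fintype V] (n : ℕ) (hn : Fintype.card V = n)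
    (g : V → V → ℝ) (hsymm : ∀ x y, g x y = g y x) (hbd : ∀ x y, |g x y| ≤ 1)
    (μ ν : ℝ) (hμ : 0 ≤ μ) (hν0 : 0 < ν) (hν1 : ν ≤ 1)
    (hdeg : ∀ x : V, |∑ y : V, g x y| ≤ μ * n)
    (hquasi : ∀ x z : V, x ≠ z → ∑ y : V, g x y * g y z ≤ ν * n)
    (l : ℕ) (hl : 3 ≤ l) :
    |∑ x : Fin l → V, ∏ i : Fin (l - 1),
        g (x ⟨i.1, Nat.lt_of_lt_of_le i.isLt (Nat.sub_le l 1)⟩) (x ⟨i.1 + 1, by omega⟩)| ≤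
      2 * μ ^ (l + 1 - 2 * (l / 2)) * ν ^ (l / 2 - 1) * (n : ℝ) ^ l +
        2 * μ ^ (l + 1 - 2 * (l / 2)) / ν ^ 3 * (n : ℝ) ^ (l - 1) := by
  subst hn
  obtain ⟨k, rfl⟩ : ∃ k, l = k + 1 := ⟨l - 1, by omega⟩
  have hpath : ∑ x : Fin (k + 1) → V, ∏ i : Fin (k + 1 - 1),
      g (x ⟨i.1, Nat.lt_of_lt_of_le i.isLt (Nat.sub_le (k + 1) 1)⟩) (x ⟨i.1 + 1, by omega⟩) =
      ∑ x, ((kernelOp g)^[k] fun _ => 1) x := by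
    rw [← sum_path_eq_sum_iterate g hsymm k]
    simp only [one_mul]
    rfl
  rw [hpath]
  rcases isEmpty_or_nonempty V with hV | hV
  · simp only [Finset.univ_eq_empty, Finset.sum_empty, abs_zero]
    positivity
  obtain ⟨ρ, hρ, hop, hnum⟩ := exists_sum_sq_kernelOp_le g hsymm hbd ν hν0 hν1 hquasi
  have hbound := abs_sum_iterate_kernelOp_le g hsymm μ ρ hμ hρ hdeg hop
  set N : ℝ := (Fintype.card V : ℝ) with hN
  obtain ⟨m, rfl | rfl⟩ : ∃ m, k = 2 * m + 1 ∨ k = 2 * m + 2 := ⟨(k - 1) / 2, by omega⟩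
  · have h := hbound m (fun _ => 1) 1 zero_le_one (by simp)
    have e1 : 2 * m + 1 + 1 + 1 - 2 * ((2 * m + 1 + 1) / 2) = 1 := by omega
    have e2 : (2 * m + 1 + 1) / 2 - 1 = m := by omega
    rw [e1, e2, Nat.add_sub_cancel]
    refine h.trans ?_
    have := mul_le_mul_of_nonneg_left (hnum m) (by positivity : 0 ≤ μ * N ^ (2 * m + 1))
    calc μ * 1 * N ^ (2 * m + 2) * ρ ^ m = μ * N ^ (2 * m + 1) * (N * ρ ^ m) := by ring
      _ ≤ _ := this
      _ = _ := by ring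
  · have h := hbound m (kernelOp g fun _ => 1) (μ * N) (by positivity)
      (fun x => by simpa [kernelOp] using hdeg x)
    rw [← Function.iterate_succ_apply] at h
    have e1 : 2 * m + 2 + 1 + 1 - 2 * ((2 * m + 2 + 1) / 2) = 2 := by omega
    have e2 : (2 * m + 2 + 1) / 2 - 1 = m := by omega
    rw [e1, e2, Nat.add_sub_cancel]
    refine h.trans ?_
    have := mul_le_mul_of_nonneg_left (hnum m) (by positivity : 0 ≤ μ ^ 2 * N ^ (2 * m + 2))
    calc μ * (μ * N) * N ^ (2 * m + 2) * ρ ^ m = μ ^ 2 * N ^ (2 * m + 2) * (N * ρ ^ m) := by ring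
      _ ≤ _ := this
      _ = _ := by ring
end

section
/- Let r ≥ 4, let α_r be the smooth cutoff function of the paper (twice differentiable, with |α_r'| ≤ r², |α_r''| ≤ 20r³), and set φ_r(k,l) = α_r(l/k)·log(k+l). Then for all real k, l ≥ 200·r^{10} and m ∈ {1, 2, r-1}: exp(φ_r(k,l) - φ_r(k-m,l)) ≤ 1 + m·Γ where Γ = α_r(l/k)/(k+l) - α_r'(l/k)·l·log(k+l)/k² + 1/(4(k+l)); and exp(φ_r(k,l) - φ_r(k,l-m)) ≤ 1 + m·Δ where Δ = α_r(l/k)/(k+l) + α_r'(l/k)·log(k+l)/k + 1/(4(k+l)). -/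
/-- The quintic smoothstep polynomial. -/
noncomputable def betaP (z : ℝ) : ℝ := 6 * z ^ 5 - 15 * z ^ 4 + 10 * z ^ 3

/-- The cutoff function on `[0, 1]`. -/
noncomputable def alphaAux (r : ℕ) (x : ℝ) : ℝ :=
  if x ≤ 1 - 1 / (2 * r) then 0
  else ((r : ℝ) - 4) / 4 * betaP (2 * r * x - (2 * r - 1))

/-- The cutoff function `α_r` of the paper, extended by `α_r(x) = α_r(1/x)` for `x ≥ 1`. -/
noncomputable def alphaFn (r : ℕ) (x : ℝ) : ℝ :=
  if x ≤ 1 then alphaAux r x else alphaAux r (1 / x)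

/-- `φ_r(k, l) = α_r(l/k) log(k + l)`. -/
noncomputable def phiFn (r : ℕ) (k l : ℝ) : ℝ := alphaFn r (l / k) * Real.log (k + l)

open Real Set

/-- The parabola `z (1 - z)` truncated at `0`. -/
noncomputable def bump (z : ℝ) : ℝ := max 0 (z * (1 - z))

/-- The quintic smoothstep, extended by the constants `0` and `1`. -/
noncomputable def smoothstep (z : ℝ) : ℝ := if z ≤ 0 then 0 else if z ≤ 1 then betaP z else 1

theorem bump_nonneg (z : ℝ) : 0 ≤ bump z := le_max_left _ _

theorem bump_le (z : ℝ) : bump z ≤ 1 / 4 :=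
  max_le (by norm_num) (by nlinarith [sq_nonneg (z - 1 / 2)])

theorem bump_of_nonpos {z : ℝ} (hz : z ≤ 0) : bump z = 0 :=
  max_eq_left (by nlinarith)

theorem bump_of_one_le {z : ℝ} (hz : 1 ≤ z) : bump z = 0 :=
  max_eq_left (by nlinarith)

theorem bump_of_mem {z : ℝ} (h0 : 0 ≤ z) (h1 : z ≤ 1) : bump z = z * (1 - z) :=
  max_eq_right (by nlinarith)

theorem bump_sub_le (z w : ℝ) : bump z - bump w ≤ |z - w| := by
  have hw := bump_nonneg w
  rcases le_total z 0 with hz | hz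
  · rw [bump_of_nonpos hz]; linarith [abs_nonneg (z - w)]
  rcases le_total 1 z with hz1 | hz1
  · rw [bump_of_one_le hz1]; linarith [abs_nonneg (z - w)]
  rw [bump_of_mem hz hz1]
  rcases le_total w 0 with h | h
  · rw [bump_of_nonpos h, abs_of_nonneg (by linarith)]; nlinarith
  rcases le_total 1 w with h1 | h1
  · rw [bump_of_one_le h1, abs_of_nonpos (by linarith)]; nlinarith
  rw [bump_of_mem h h1]
  rcases le_total z w with h2 | h2
  · rw [abs_of_nonpos (by linarith)]; nlinarith
  · rw [abs_of_nonneg (by linarith)]; nlinarith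

theorem abs_bump_sq_sub_le (z w : ℝ) : |bump z ^ 2 - bump w ^ 2| ≤ |z - w| / 2 := by
  have h : |bump z - bump w| ≤ |z - w| :=
    abs_le.2 ⟨by linarith [bump_sub_le w z, abs_sub_comm z w], bump_sub_le z w⟩
  have hs : |bump z + bump w| ≤ 1 / 2 := by
    rw [abs_of_nonneg (add_nonneg (bump_nonneg z) (bump_nonneg w))]
    linarith [bump_le z, bump_le w]
  calc |bump z ^ 2 - bump w ^ 2| = |bump z - bump w| * |bump z + bump w| := by
        rw [← abs_mul]; ring_nf
    _ ≤ |z - w| * (1 / 2) := by gcongr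
    _ = |z - w| / 2 := by ring

theorem bump_sq_le (z : ℝ) : bump z ^ 2 ≤ 1 / 16 := by
  nlinarith [bump_nonneg z, bump_le z]

theorem HasDerivAt.of_eqOn_Icc {f g h : ℝ → ℝ} {a d : ℝ} (hf : HasDerivAt f d a)
    (hg : HasDerivAt g d a) (hl : ∀ x ∈ Icc (a - 1) a, h x = f x)
    (hr : ∀ x ∈ Icc a (a + 1), h x = g x) :
    HasDerivAt h d a := by
  have h1 : HasDerivWithinAt h d (Icc (a - 1) a) a :=
    hf.hasDerivWithinAt.congr hl (hl a (by simp))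
  have h2 : HasDerivWithinAt h d (Icc a (a + 1)) a :=
    hg.hasDerivWithinAt.congr hr (hr a (by simp))
  have h3 := h1.union h2
  rw [Icc_union_Icc_eq_Icc (by linarith) (by linarith)] at h3
  exact h3.hasDerivAt (Icc_mem_nhds (by linarith) (by linarith))

theorem hasDerivAt_betaP (z : ℝ) : HasDerivAt betaP (30 * (z * (1 - z)) ^ 2) z := by
  have h := ((((hasDerivAt_pow 5 z).const_mul 6).sub ((hasDerivAt_pow 4 z).const_mul 15)).add
    ((hasDerivAt_pow 3 z).const_mul 10))
  refine HasDerivAt.congr_deriv (f := betaP) h ?_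
  norm_num
  ring

theorem smoothstep_of_nonpos {z : ℝ} (hz : z ≤ 0) : smoothstep z = 0 := if_pos hz

theorem smoothstep_of_mem {z : ℝ} (h0 : 0 ≤ z) (h1 : z ≤ 1) : smoothstep z = betaP z := by
  rcases h0.eq_or_lt with rfl | h
  · simp [smoothstep, betaP]
  · rw [smoothstep, if_neg h.not_ge, if_pos h1]

theorem smoothstep_of_one_le {z : ℝ} (hz : 1 ≤ z) : smoothstep z = 1 := by
  rcases hz.eq_or_lt with rfl | h
  · norm_num [smoothstep, betaP]
  · rw [smoothstep, if_neg (by linarith), if_neg h.not_ge]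

theorem hasDerivAt_smoothstep (z : ℝ) : HasDerivAt smoothstep (30 * bump z ^ 2) z := by
  rcases lt_trichotomy z 0 with hz | rfl | hz
  · rw [bump_of_nonpos hz.le]
    refine ((hasDerivAt_const z (0 : ℝ)).congr_deriv (by norm_num)).congr_of_eventuallyEq ?_
    filter_upwards [Iio_mem_nhds hz] with x hx using smoothstep_of_nonpos (le_of_lt hx)
  · rw [bump_of_nonpos le_rfl]
    refine HasDerivAt.of_eqOn_Icc
      ((hasDerivAt_const (0 : ℝ) (0 : ℝ)).congr_deriv (by norm_num))
      ((hasDerivAt_betaP 0).congr_deriv (by norm_num))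
      (fun x hx => smoothstep_of_nonpos hx.2)
      (fun x hx => smoothstep_of_mem hx.1 (by linarith [hx.2]))
  rcases lt_trichotomy z 1 with hz1 | rfl | hz1
  · rw [bump_of_mem hz.le hz1.le]
    refine (hasDerivAt_betaP z).congr_of_eventuallyEq ?_
    filter_upwards [Ioo_mem_nhds hz hz1] with x hx using smoothstep_of_mem hx.1.le hx.2.le
  · rw [bump_of_one_le le_rfl]
    refine HasDerivAt.of_eqOn_Icc
      ((hasDerivAt_betaP 1).congr_deriv (by norm_num))
      ((hasDerivAt_const (1 : ℝ) (1 : ℝ)).congr_deriv (by norm_num))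
      (fun x hx => smoothstep_of_mem (by linarith [hx.1]) hx.2)
      (fun x hx => smoothstep_of_one_le hx.1)
  · rw [bump_of_one_le hz1.le]
    refine ((hasDerivAt_const z (1 : ℝ)).congr_deriv (by norm_num)).congr_of_eventuallyEq ?_
    filter_upwards [Ioi_mem_nhds hz1] with x hx using smoothstep_of_one_le (le_of_lt hx)

theorem smoothstep_mem_Icc (z : ℝ) : smoothstep z ∈ Icc (0 : ℝ) 1 := by
  have hmono : Monotone smoothstep :=
    monotone_of_deriv_nonneg (fun x => (hasDerivAt_smoothstep x).differentiableAt) fun x => by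
      rw [(hasDerivAt_smoothstep x).deriv]; positivity
  constructor
  · rw [← smoothstep_of_nonpos (min_le_right z 0)]
    exact hmono (min_le_left z 0)
  · rw [← smoothstep_of_one_le (le_max_right z 1)]
    exact hmono (le_max_left z 1)

theorem alphaAux_eq {r : ℕ} (hr : 4 ≤ r) {x : ℝ} (hx : x ≤ 1) :
    alphaAux r x = ((r : ℝ) - 4) / 4 * smoothstep (2 * r * x - (2 * r - 1)) := by
  have hr' : (4 : ℝ) ≤ r := by exact_mod_cast hr
  have key : 2 * r * x - (2 * r - 1) = 2 * r * (x - (1 - 1 / (2 * r))) := by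
    field_simp
  rw [alphaAux]
  split_ifs with h
  · rw [smoothstep_of_nonpos, mul_zero]
    rw [key]
    exact mul_nonpos_of_nonneg_of_nonpos (by positivity) (by linarith)
  · rw [smoothstep_of_mem]
    · rw [key]
      exact mul_nonneg (by positivity) (by linarith)
    · nlinarith

/-- A formula for `α_r` on `(0, ∞)` that avoids the case distinction. -/
theorem alphaFn_eq {r : ℕ} (hr : 4 ≤ r) {x : ℝ} (hx : 0 < x) :
    alphaFn r x = ((r : ℝ) - 4) / 4 * (smoothstep (2 * r * x - (2 * r - 1)) +
      smoothstep (2 * r * x⁻¹ - (2 * r - 1)) - 1) := by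
  have hr' : (4 : ℝ) ≤ r := by exact_mod_cast hr
  rw [alphaFn]
  split_ifs with h
  · have h1 : 1 ≤ x⁻¹ := (one_le_inv₀ hx).2 h
    rw [alphaAux_eq hr h, smoothstep_of_one_le (z := 2 * r * x⁻¹ - (2 * r - 1)) (by nlinarith)]
    ring
  · push Not at h
    have h1 : x⁻¹ ≤ 1 := inv_le_one_of_one_le₀ h.le
    rw [one_div, alphaAux_eq hr h1, smoothstep_of_one_le (z := 2 * r * x - (2 * r - 1))
      (by nlinarith)]
    ring

theorem alphaFn_inv {r : ℕ} (hr : 4 ≤ r) {x : ℝ} (hx : 0 < x) :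
    alphaFn r x⁻¹ = alphaFn r x := by
  rw [alphaFn_eq hr hx, alphaFn_eq hr (inv_pos.2 hx), inv_inv]
  ring

/-- The derivative of `α_r` on `(0, ∞)`. -/
noncomputable def alphaDeriv (r : ℕ) (x : ℝ) : ℝ :=
  15 * (r * ((r : ℝ) - 4)) * (bump (2 * r * x - (2 * r - 1)) ^ 2 -
    bump (2 * r * x⁻¹ - (2 * r - 1)) ^ 2 * (x⁻¹) ^ 2)

theorem hasDerivAt_alphaFn {r : ℕ} (hr : 4 ≤ r) {x : ℝ} (hx : 0 < x) :
    HasDerivAt (alphaFn r) (alphaDeriv r x) x := by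
  have h1 : HasDerivAt (fun y : ℝ => 2 * r * y - (2 * r - 1)) (2 * r) x := by
    simpa using ((hasDerivAt_id x).const_mul (2 * (r : ℝ))).sub_const (2 * (r : ℝ) - 1)
  have h2 := ((hasDerivAt_inv hx.ne').const_mul (2 * (r : ℝ))).sub_const (2 * (r : ℝ) - 1)
  have h := ((((hasDerivAt_smoothstep _).comp x h1).add
    ((hasDerivAt_smoothstep _).comp x h2)).sub_const 1).const_mul (((r : ℝ) - 4) / 4)
  refine (h.congr_deriv ?_).congr_of_eventuallyEq ?_
  · simp only [alphaDeriv]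
    rw [inv_pow]
    ring
  · filter_upwards [Ioi_mem_nhds hx] with y hy
    simpa using alphaFn_eq hr hy

theorem abs_alphaFn_le {r : ℕ} (hr : 4 ≤ r) {x : ℝ} (hx : 0 < x) : |alphaFn r x| ≤ r / 4 := by
  have hr' : (4 : ℝ) ≤ r := by exact_mod_cast hr
  rw [alphaFn_eq hr hx, abs_mul, abs_of_nonneg (by linarith)]
  obtain ⟨a1, a2⟩ := smoothstep_mem_Icc (2 * r * x - (2 * r - 1))
  obtain ⟨b1, b2⟩ := smoothstep_mem_Icc (2 * r * x⁻¹ - (2 * r - 1))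
  calc _ ≤ ((r : ℝ) - 4) / 4 * 1 :=
        mul_le_mul_of_nonneg_left (abs_le.2 ⟨by linarith, by linarith⟩) (by linarith)
    _ ≤ r / 4 := by linarith

theorem inv_le_of_seven_tenths_le {x : ℝ} (hx : 7 / 10 ≤ x) : x⁻¹ ≤ 10 / 7 := by
  rw [inv_le_comm₀ (by linarith) (by norm_num)]
  linarith

theorem abs_alphaDeriv_le {r : ℕ} (hr : 4 ≤ r) {x : ℝ} (hx : 7 / 10 ≤ x) :
    |alphaDeriv r x| ≤ 2 * r ^ 2 := by
  have hr' : (4 : ℝ) ≤ r := by exact_mod_cast hr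
  have hi := inv_le_of_seven_tenths_le hx
  have hi0 : 0 < x⁻¹ := inv_pos.2 (by linarith)
  have hi2 : (x⁻¹) ^ 2 ≤ 100 / 49 := by nlinarith
  have hq : 0 ≤ 15 * (r * ((r : ℝ) - 4)) := by
    have : 0 ≤ (r : ℝ) - 4 := by linarith
    positivity
  rw [alphaDeriv, abs_mul, abs_of_nonneg hq]
  have hb : |bump (2 * r * x - (2 * r - 1)) ^ 2 -
      bump (2 * r * x⁻¹ - (2 * r - 1)) ^ 2 * (x⁻¹) ^ 2| ≤ 100 / 49 / 16 := by
    have e1 := bump_sq_le (2 * r * x - (2 * r - 1))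
    have e2 := bump_sq_le (2 * r * x⁻¹ - (2 * r - 1))
    have e3 : bump (2 * r * x⁻¹ - (2 * r - 1)) ^ 2 * (x⁻¹) ^ 2 ≤ 1 / 16 * (100 / 49) := by
      gcongr
    have e4 : 0 ≤ bump (2 * r * x⁻¹ - (2 * r - 1)) ^ 2 * (x⁻¹) ^ 2 := by positivity
    have e5 : 0 ≤ bump (2 * r * x - (2 * r - 1)) ^ 2 := by positivity
    exact abs_le.2 ⟨by linarith, by linarith⟩
  calc _ ≤ 15 * (r * ((r : ℝ) - 4)) * (100 / 49 / 16) := by gcongr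
    _ ≤ 2 * r ^ 2 := by nlinarith

theorem abs_alphaDeriv_sub_le {r : ℕ} (hr : 4 ≤ r) {x y : ℝ} (hx : 7 / 10 ≤ x)
    (hy : 7 / 10 ≤ y) : |alphaDeriv r x - alphaDeriv r y| ≤ 100 * r ^ 3 * |x - y| := by
  have hr' : (4 : ℝ) ≤ r := by exact_mod_cast hr
  have hx0 : 0 < x := by linarith
  have hy0 : 0 < y := by linarith
  have hix := inv_le_of_seven_tenths_le hx
  have hiy := inv_le_of_seven_tenths_le hy
  have hix0 : 0 < x⁻¹ := inv_pos.2 hx0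
  have hiy0 : 0 < y⁻¹ := inv_pos.2 hy0
  have hinv : |x⁻¹ - y⁻¹| ≤ 100 / 49 * |x - y| := by
    have : x⁻¹ - y⁻¹ = (x⁻¹ * y⁻¹) * (y - x) := by field_simp
    rw [this, abs_mul, abs_of_pos (by positivity), abs_sub_comm y x]
    gcongr
    nlinarith
  have hq : 0 ≤ 15 * (r * ((r : ℝ) - 4)) := by
    have : 0 ≤ (r : ℝ) - 4 := by linarith
    positivity
  set d := |x - y| with hd
  have hd0 : 0 ≤ d := abs_nonneg _
  have b1 : |bump (2 * r * x - (2 * r - 1)) ^ 2 - bump (2 * r * y - (2 * r - 1)) ^ 2| ≤ r * d := by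
    refine (abs_bump_sq_sub_le _ _).trans (le_of_eq ?_)
    rw [show 2 * r * x - (2 * r - 1) - (2 * r * y - (2 * r - 1)) = 2 * r * (x - y) by ring,
      abs_mul, abs_of_nonneg (by positivity)]
    ring
  have b2 : |bump (2 * r * x⁻¹ - (2 * r - 1)) ^ 2 - bump (2 * r * y⁻¹ - (2 * r - 1)) ^ 2| ≤
      r * (100 / 49 * d) := by
    refine (abs_bump_sq_sub_le _ _).trans ?_
    rw [show 2 * r * x⁻¹ - (2 * r - 1) - (2 * r * y⁻¹ - (2 * r - 1)) = 2 * r * (x⁻¹ - y⁻¹) by ring,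
      abs_mul, abs_of_nonneg (by positivity)]
    nlinarith
  have b3 : |(x⁻¹) ^ 2 - (y⁻¹) ^ 2| ≤ 20 / 7 * (100 / 49 * d) := by
    rw [sq_sub_sq, abs_mul, abs_of_pos (by positivity)]
    gcongr
    linarith
  have hb := bump_sq_le (2 * r * y⁻¹ - (2 * r - 1))
  rw [alphaDeriv, alphaDeriv]
  generalize bump (2 * r * x - (2 * r - 1)) ^ 2 = p at *
  generalize bump (2 * r * y - (2 * r - 1)) ^ 2 = p' at *
  have hq' : 0 ≤ bump (2 * r * y⁻¹ - (2 * r - 1)) ^ 2 := by positivity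
  generalize bump (2 * r * x⁻¹ - (2 * r - 1)) ^ 2 = q at *
  generalize bump (2 * r * y⁻¹ - (2 * r - 1)) ^ 2 = q' at *
  have hsum : |(p - p') - (q - q') * (x⁻¹) ^ 2 - q' * ((x⁻¹) ^ 2 - (y⁻¹) ^ 2)| ≤ 6 * r * d := by
    have hi2 : (x⁻¹) ^ 2 ≤ 100 / 49 := by nlinarith
    have t2 : |(q - q') * (x⁻¹) ^ 2| ≤ r * (100 / 49 * d) * (100 / 49) := by
      rw [abs_mul, abs_of_nonneg (sq_nonneg x⁻¹)]
      gcongr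
    have t3 : |q' * ((x⁻¹) ^ 2 - (y⁻¹) ^ 2)| ≤ 1 / 16 * (20 / 7 * (100 / 49 * d)) := by
      rw [abs_mul, abs_of_nonneg hq']
      gcongr
    refine (abs_sub _ _).trans ((add_le_add (abs_sub _ _) le_rfl).trans ?_)
    nlinarith
  calc _ = |15 * (r * ((r : ℝ) - 4)) *
        ((p - p') - (q - q') * (x⁻¹) ^ 2 - q' * ((x⁻¹) ^ 2 - (y⁻¹) ^ 2))| := by
        congr 1; ring
    _ ≤ 15 * (r * ((r : ℝ) - 4)) * (6 * r * d) := by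
        rw [abs_mul, abs_of_nonneg hq]; gcongr
    _ ≤ 100 * r ^ 3 * d := by
        have : 0 ≤ (r : ℝ) ^ 2 * d := by positivity
        nlinarith

theorem abs_alphaFn_sub_le {r : ℕ} (hr : 4 ≤ r) {x y : ℝ} (hx : 7 / 10 ≤ x)
    (hy : 7 / 10 ≤ y) : |alphaFn r x - alphaFn r y| ≤ 2 * r ^ 2 * |x - y| :=
  Convex.norm_image_sub_le_of_norm_hasDerivWithin_le (s := Ici (7 / 10 : ℝ))
    (fun t ht => (hasDerivAt_alphaFn hr
      (by linarith [mem_Ici.1 ht] : (0 : ℝ) < t)).hasDerivWithinAt)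
    (fun t ht => abs_alphaDeriv_le hr ht) (convex_Ici _) hy hx

theorem alphaFn_eq_zero_of_le {r : ℕ} (hr : 4 ≤ r) {x : ℝ} (hx0 : 0 < x) (hx : x ≤ 7 / 8) :
    alphaFn r x = 0 := by
  have hr' : (4 : ℝ) ≤ r := by exact_mod_cast hr
  have h1 : 1 ≤ x⁻¹ := (one_le_inv₀ hx0).2 (by linarith)
  rw [alphaFn_eq hr hx0, smoothstep_of_nonpos (by nlinarith), smoothstep_of_one_le (by nlinarith)]
  ring

theorem alphaDeriv_eq_zero_of_le {r : ℕ} (hr : 4 ≤ r) {x : ℝ} (hx0 : 0 < x) (hx : x ≤ 7 / 8) :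
    alphaDeriv r x = 0 := by
  have hr' : (4 : ℝ) ≤ r := by exact_mod_cast hr
  have h1 : 1 ≤ x⁻¹ := (one_le_inv₀ hx0).2 (by linarith)
  rw [alphaDeriv, bump_of_nonpos (by nlinarith), bump_of_one_le (by nlinarith)]
  ring

theorem alphaDeriv_eq_zero_of_ge {r : ℕ} (hr : 4 ≤ r) {x : ℝ} (hx : 8 / 7 ≤ x) :
    alphaDeriv r x = 0 := by
  have hr' : (4 : ℝ) ≤ r := by exact_mod_cast hr
  have h1 : x⁻¹ ≤ 7 / 8 := by
    rw [inv_le_comm₀ (by linarith) (by norm_num)]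
    linarith
  rw [alphaDeriv, bump_of_one_le (by nlinarith), bump_of_nonpos (by nlinarith)]
  ring

theorem alphaFn_eq_zero_of_ge {r : ℕ} (hr : 4 ≤ r) {x : ℝ} (hx : 8 / 7 ≤ x) :
    alphaFn r x = 0 := by
  have hx0 : 0 < x := by linarith
  rw [← alphaFn_inv hr hx0]
  refine alphaFn_eq_zero_of_le hr (inv_pos.2 hx0) ?_
  rw [inv_le_comm₀ hx0 (by norm_num)]
  linarith

theorem pow_five_mul_log_sq_le {R N : ℝ} (hR : 4 ≤ R) (hN : 400 * R ^ 10 ≤ N) :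
    720 * (R ^ 5 * log N ^ 2) ≤ N := by
  have hR10 : (4 : ℝ) ^ 10 ≤ R ^ 10 := by gcongr
  have hN0 : 0 < N := by linarith
  set s := √N with hs
  set t := √s with ht
  have hsN : s ^ 2 = N := sq_sqrt hN0.le
  have hts : t ^ 2 = s := sq_sqrt (sqrt_nonneg N)
  have hs20 : 20 * R ^ 5 ≤ s := by
    refine le_sqrt_of_sq_le ?_
    nlinarith
  have hR5 : (4 : ℝ) ^ 5 ≤ R ^ 5 := by gcongr
  have ht140 : 140 ≤ t := by
    refine le_sqrt_of_sq_le ?_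
    linarith
  have hlog140 : log 140 ≤ 5 := by
    rw [log_le_iff_le_exp (by norm_num)]
    have h : (2.71 : ℝ) ≤ exp 1 := by linarith [exp_one_gt_d9]
    calc (140 : ℝ) ≤ 2.71 ^ 5 := by norm_num
      _ ≤ exp 1 ^ 5 := by gcongr
      _ = exp 5 := by rw [← exp_nat_mul]; norm_num
  have hlogt : log t ≤ 4 + t / 140 := by
    have h := log_le_sub_one_of_pos (show 0 < t / 140 by positivity)
    rw [log_div (by positivity) (by norm_num)] at h
    linarith
  have hlogN : log N = 4 * log t := by
    rw [← hsN, ← hts, log_pow, log_pow]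
    push_cast
    ring
  have hL0 : 0 ≤ log N := log_nonneg (by linarith)
  have hL : log N ≤ t / 6 := by linarith
  have hL2 : log N ^ 2 ≤ s / 36 := by
    rw [← hts]
    nlinarith
  calc 720 * (R ^ 5 * log N ^ 2) ≤ 720 * (s / 20 * (s / 36)) := by
        gcongr
        linarith
    _ = N := by rw [← hsN]; ring

theorem ten_le_log {N : ℝ} (hN : 400 * 4 ^ 10 ≤ N) : 10 ≤ log N := by
  rw [le_log_iff_exp_le (by linarith)]
  have h : exp 1 ≤ (2.72 : ℝ) := by linarith [exp_one_lt_d9]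
  calc exp 10 = exp 1 ^ 10 := by rw [← exp_nat_mul]; norm_num
    _ ≤ 2.72 ^ 10 := by gcongr
    _ ≤ 400 * 4 ^ 10 := by norm_num
    _ ≤ N := hN

/-- The derivative of `φ_r` with respect to its second argument. -/
noncomputable def phiDeriv (r : ℕ) (k t : ℝ) : ℝ :=
  alphaFn r (t / k) / (k + t) + alphaDeriv r (t / k) * log (k + t) / k

theorem hasDerivAt_phiFn {r : ℕ} (hr : 4 ≤ r) {k t : ℝ} (hk : 0 < k) (ht : 0 < t) :
    HasDerivAt (fun s => phiFn r k s) (phiDeriv r k t) t := by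
  have h1 := (hasDerivAt_alphaFn hr (div_pos ht hk)).comp t ((hasDerivAt_id t).div_const k)
  have h2 := ((hasDerivAt_id t).const_add k).log (by simp; positivity)
  refine (h1.mul h2).congr_deriv ?_
  simp only [phiDeriv, Function.comp, id]
  ring

theorem exp_le_of_abs_le_one {z : ℝ} (hz : |z| ≤ 1) : exp z ≤ 1 + z + z ^ 2 := by
  have h := (abs_le.1 (abs_exp_sub_one_sub_id_le hz)).2
  linarith

theorem sum_estimates {r : ℕ} (hr : 4 ≤ r) {k l t : ℝ} (hN : 400 * (r : ℝ) ^ 10 ≤ k + l)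
    (hk : 3 / 7 * (k + l) ≤ k) (ht : l - r ≤ t) :
    0 < k + l ∧ 0 < k ∧ 1 ≤ k + t ∧ k⁻¹ ≤ 7 / 3 * (k + l)⁻¹ ∧ (k + t)⁻¹ ≤ 2 * (k + l)⁻¹ ∧
      10 ≤ log (k + l) := by
  have hr' : (4 : ℝ) ≤ r := by exact_mod_cast hr
  have hr9 : (r : ℝ) * 4 ^ 9 ≤ r ^ 10 := by
    rw [show (r : ℝ) ^ 10 = r * r ^ 9 by ring]
    gcongr
  have hN0 : 0 < k + l := by linarith
  refine ⟨hN0, by linarith, by linarith, ?_, ?_, ten_le_log (by linarith)⟩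
  · rw [show 7 / 3 * (k + l)⁻¹ = (3 / 7 * (k + l))⁻¹ by rw [mul_inv]; norm_num]
    exact inv_anti₀ (by linarith) hk
  · rw [show 2 * (k + l)⁻¹ = (1 / 2 * (k + l))⁻¹ by rw [mul_inv]; norm_num]
    exact inv_anti₀ (by linarith) (by linarith)

theorem abs_phiDeriv_le {r : ℕ} (hr : 4 ≤ r) {k l t : ℝ} (hN : 400 * (r : ℝ) ^ 10 ≤ k + l)
    (hk : 3 / 7 * (k + l) ≤ k) (ht : l - r ≤ t) (htl : t ≤ l) (hx : 7 / 10 ≤ t / k) :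
    |phiDeriv r k t| ≤ 5 * r ^ 2 * log (k + l) / (k + l) := by
  have hr' : (4 : ℝ) ≤ r := by exact_mod_cast hr
  obtain ⟨hN0, hk0, hkt, hkinv, hktinv, hL⟩ := sum_estimates hr hN hk ht
  have hlog : log (k + t) ≤ log (k + l) := log_le_log (by linarith) (by linarith)
  have hlog0 : 0 ≤ log (k + t) := log_nonneg hkt
  have hα := abs_alphaFn_le hr (by linarith : 0 < t / k)
  have hD := abs_alphaDeriv_le hr hx
  have hval : phiDeriv r k t = alphaFn r (t / k) * (k + t)⁻¹ +
      alphaDeriv r (t / k) * log (k + t) * k⁻¹ := by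
    simp only [phiDeriv, div_eq_mul_inv]
  rw [hval, div_eq_mul_inv _ (k + l)]
  set w := (k + l)⁻¹
  have hw : 0 < w := inv_pos.2 hN0
  have hkt0 : 0 < k + t := by linarith
  have h1 : |alphaFn r (t / k) * (k + t)⁻¹| ≤ r / 4 * (2 * w) := by
    rw [abs_mul, abs_of_pos (inv_pos.2 hkt0)]
    gcongr
  have h2 : |alphaDeriv r (t / k) * log (k + t) * k⁻¹| ≤
      2 * r ^ 2 * log (k + l) * (7 / 3 * w) := by
    rw [abs_mul, abs_mul, abs_of_nonneg hlog0, abs_of_pos (inv_pos.2 hk0)]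
    gcongr
  refine (abs_add_le _ _).trans ((add_le_add h1 h2).trans ?_)
  have h3 : (r : ℝ) ≤ r ^ 2 * log (k + l) * (1 / 4) := by
    have : 4 ≤ r * log (k + l) := by nlinarith
    nlinarith
  nlinarith

theorem phiDeriv_sub_le {r : ℕ} (hr : 4 ≤ r) {k l t : ℝ} (hN : 400 * (r : ℝ) ^ 10 ≤ k + l)
    (hk : 3 / 7 * (k + l) ≤ k) (ht : l - r ≤ t) (htl : t ≤ l) (hx : 7 / 10 ≤ t / k) :
    phiDeriv r k t - phiDeriv r k l ≤ 600 * r ^ 4 * log (k + l) / (k + l) ^ 2 := by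
  have hr' : (4 : ℝ) ≤ r := by exact_mod_cast hr
  obtain ⟨hN0, hk0, hkt, hkinv, hktinv, hL⟩ := sum_estimates hr hN hk ht
  have hkt0 : 0 < k + t := by linarith
  have hlog : log (k + t) ≤ log (k + l) := log_le_log hkt0 (by linarith)
  have hlog0 : 0 ≤ log (k + t) := log_nonneg hkt
  have hxl : 7 / 10 ≤ l / k := hx.trans (by gcongr)
  have hα := abs_alphaFn_le hr (by linarith : 0 < l / k)
  have hD := abs_alphaDeriv_le hr hxl
  have hw : 0 < (k + l)⁻¹ := inv_pos.2 hN0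
  have hdist : |t / k - l / k| ≤ r * (7 / 3 * (k + l)⁻¹) := by
    rw [← sub_div, abs_div, abs_of_nonpos (by linarith), abs_of_pos hk0, div_eq_mul_inv]
    gcongr
    linarith
  have hdα : |alphaFn r (t / k) - alphaFn r (l / k)| ≤
      2 * r ^ 2 * (r * (7 / 3 * (k + l)⁻¹)) :=
    (abs_alphaFn_sub_le hr hx hxl).trans (by gcongr)
  have hdD : |alphaDeriv r (t / k) - alphaDeriv r (l / k)| ≤
      100 * r ^ 3 * (r * (7 / 3 * (k + l)⁻¹)) :=
    (abs_alphaDeriv_sub_le hr hx hxl).trans (by gcongr)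
  have hdinv : |(k + t)⁻¹ - (k + l)⁻¹| ≤ r * (2 * (k + l)⁻¹) * (k + l)⁻¹ := by
    have : (k + t)⁻¹ - (k + l)⁻¹ = (l - t) * (k + t)⁻¹ * (k + l)⁻¹ := by
      field_simp
      ring
    rw [this, abs_of_nonneg (by have : 0 ≤ l - t := by linarith
                                positivity)]
    gcongr
    linarith
  have hdlog : |log (k + t) - log (k + l)| ≤ r * (2 * (k + l)⁻¹) := by
    rw [abs_of_nonpos (by linarith)]
    have h := log_le_sub_one_of_pos (div_pos hN0 hkt0)
    rw [log_div hN0.ne' hkt0.ne'] at h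
    have h2 : (k + l) / (k + t) - 1 = (l - t) * (k + t)⁻¹ := by
      field_simp
      ring
    have h3 : (l - t) * (k + t)⁻¹ ≤ r * (2 * (k + l)⁻¹) := by
      gcongr
      linarith
    linarith
  have hsplit : phiDeriv r k t - phiDeriv r k l =
      (alphaFn r (t / k) - alphaFn r (l / k)) * (k + t)⁻¹ +
      alphaFn r (l / k) * ((k + t)⁻¹ - (k + l)⁻¹) +
      (alphaDeriv r (t / k) - alphaDeriv r (l / k)) * log (k + t) * k⁻¹ +
      alphaDeriv r (l / k) * (log (k + t) - log (k + l)) * k⁻¹ := by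
    simp only [phiDeriv, div_eq_mul_inv]
    ring
  rw [hsplit, div_eq_mul_inv _ ((k + l) ^ 2), ← inv_pow]
  have h1 : (alphaFn r (t / k) - alphaFn r (l / k)) * (k + t)⁻¹ ≤
      2 * r ^ 2 * (r * (7 / 3 * (k + l)⁻¹)) * (2 * (k + l)⁻¹) := by
    refine (le_abs_self _).trans ?_
    rw [abs_mul, abs_of_pos (inv_pos.2 hkt0)]
    gcongr
  have h2 : alphaFn r (l / k) * ((k + t)⁻¹ - (k + l)⁻¹) ≤
      r / 4 * (r * (2 * (k + l)⁻¹) * (k + l)⁻¹) := by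
    refine (le_abs_self _).trans ?_
    rw [abs_mul]
    gcongr
  have h3 : (alphaDeriv r (t / k) - alphaDeriv r (l / k)) * log (k + t) * k⁻¹ ≤
      100 * r ^ 3 * (r * (7 / 3 * (k + l)⁻¹)) * log (k + l) * (7 / 3 * (k + l)⁻¹) := by
    refine (le_abs_self _).trans ?_
    rw [abs_mul, abs_mul, abs_of_nonneg hlog0, abs_of_pos (inv_pos.2 hk0)]
    gcongr
  have h4 : alphaDeriv r (l / k) * (log (k + t) - log (k + l)) * k⁻¹ ≤
      2 * r ^ 2 * (r * (2 * (k + l)⁻¹)) * (7 / 3 * (k + l)⁻¹) := by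
    refine (le_abs_self _).trans ?_
    rw [abs_mul, abs_mul, abs_of_pos (inv_pos.2 hk0)]
    gcongr
  refine (add_le_add (add_le_add (add_le_add h1 h2) h3) h4).trans ?_
  set w := (k + l)⁻¹
  set L := log (k + l)
  have hr3 : (r : ℝ) ^ 3 ≤ r ^ 4 * L := by
    rw [show (r : ℝ) ^ 4 * L = r ^ 3 * (r * L) by ring]
    exact le_mul_of_one_le_right (by positivity) (by nlinarith)
  have hr2 : (r : ℝ) ^ 2 ≤ r ^ 3 := pow_le_pow_right₀ (by linarith) (by norm_num)
  have hsum : 28 / 3 * (r : ℝ) ^ 3 + 1 / 2 * r ^ 2 + 4900 / 9 * (r ^ 4 * L) + 28 / 3 * r ^ 3 ≤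
      600 * (r ^ 4 * L) := by
    have : 0 ≤ (r : ℝ) ^ 4 * L := by positivity
    linarith
  have := mul_le_mul_of_nonneg_right hsum (sq_nonneg w)
  linarith

theorem exp_phiFn_sub_le {r : ℕ} (hr : 4 ≤ r) {k l m : ℝ}
    (hk : 200 * (r : ℝ) ^ 10 ≤ k) (hl : 200 * (r : ℝ) ^ 10 ≤ l) (hm1 : 1 ≤ m) (hmr : m ≤ r) :
    exp (phiFn r k l - phiFn r k (l - m)) ≤
      1 + m * (alphaFn r (l / k) / (k + l) +
        deriv (alphaFn r) (l / k) * log (k + l) / k + 1 / (4 * (k + l))) := by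
  have hr' : (4 : ℝ) ≤ r := by exact_mod_cast hr
  have hr9 : (r : ℝ) * 4 ^ 9 ≤ r ^ 10 := by
    rw [show (r : ℝ) ^ 10 = r * r ^ 9 by ring]
    gcongr
  have hk0 : 0 < k := by linarith
  have hl0 : 0 < l := by linarith
  have hlm : 0 < l - m := by linarith
  have hN0 : 0 < k + l := by linarith
  have hmk : m / k ≤ 1 / 100 := by rw [div_le_iff₀ hk0]; linarith
  have hsub : (l - m) / k = l / k - m / k := sub_div _ _ _
  have hlk : 0 < l / k := div_pos hl0 hk0
  have hmk0 : 0 < m / k := by positivity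
  rw [(hasDerivAt_alphaFn hr hlk).deriv]
  by_cases hfar : l / k < 3 / 4 ∨ 4 / 3 < l / k
  · have h : alphaFn r (l / k) = 0 ∧ alphaFn r ((l - m) / k) = 0 ∧ alphaDeriv r (l / k) = 0 := by
      rcases hfar with h | h
      · exact ⟨alphaFn_eq_zero_of_le hr hlk (by linarith),
          alphaFn_eq_zero_of_le hr (div_pos hlm hk0) (by linarith),
          alphaDeriv_eq_zero_of_le hr hlk (by linarith)⟩
      · exact ⟨alphaFn_eq_zero_of_ge hr (by linarith), alphaFn_eq_zero_of_ge hr (by linarith),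
          alphaDeriv_eq_zero_of_ge hr (by linarith)⟩
    obtain ⟨h1, h2, h3⟩ := h
    simp only [phiFn, h1, h2, h3, zero_mul, sub_zero, exp_zero, zero_div, zero_add]
    have : 0 ≤ m * (1 / (4 * (k + l))) := by positivity
    linarith
  push Not at hfar
  obtain ⟨hx1, hx2⟩ := hfar
  have hk37 : 3 / 7 * (k + l) ≤ k := by
    rw [div_le_iff₀ hk0] at hx2
    linarith
  obtain ⟨t, ht, htd⟩ := exists_hasDerivAt_eq_slope (fun s => phiFn r k s) (phiDeriv r k)
    (show l - m < l by linarith)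
    (fun s hs => (hasDerivAt_phiFn hr hk0
      (by linarith [hs.1] : 0 < s)).continuousAt.continuousWithinAt)
    (fun s hs => hasDerivAt_phiFn hr hk0 (by linarith [hs.1] : 0 < s))
  have hz : phiFn r k l - phiFn r k (l - m) = m * phiDeriv r k t := by
    rw [htd, sub_sub_cancel, mul_div_cancel₀ _ (by linarith)]
  have hx : 7 / 10 ≤ t / k := by
    have : (l - m) / k ≤ t / k := by gcongr; exact ht.1.le
    linarith
  have hN : 400 * (r : ℝ) ^ 10 ≤ k + l := by linarith
  have hA := abs_phiDeriv_le hr hN hk37 (by linarith [ht.1]) ht.2.le hx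
  have hB := phiDeriv_sub_le hr hN hk37 (by linarith [ht.1]) ht.2.le hx
  have hlogsq := pow_five_mul_log_sq_le hr' hN
  have hL := ten_le_log (N := k + l) (by linarith)
  have hval : phiDeriv r k l =
    alphaFn r (l / k) / (k + l) + alphaDeriv r (l / k) * log (k + l) / k := rfl
  rw [hz, ← hval]
  set N := k + l
  set L := log N
  set d := phiDeriv r k t
  have hB' : 600 * r ^ 4 * L / N ^ 2 ≤ 1 / 40 / N := by
    rw [div_le_div_iff₀ (by positivity) hN0]
    have h : 600 * r ^ 4 * L ≤ 1 / 40 * N := by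
      have : 40 * (r ^ 4 * L) ≤ (r : ℝ) ^ 5 * L ^ 2 := by
        have h40 : 40 ≤ r * L := by nlinarith
        calc 40 * (r ^ 4 * L) ≤ r * L * (r ^ 4 * L) := by gcongr
          _ = (r : ℝ) ^ 5 * L ^ 2 := by ring
      linarith
    nlinarith
  have hd2 : m * d ^ 2 ≤ 1 / 20 / N := by
    have h1 : d ^ 2 ≤ (5 * r ^ 2 * L / N) ^ 2 := by
      rw [← sq_abs d]
      gcongr
    calc m * d ^ 2 ≤ r * (5 * r ^ 2 * L / N) ^ 2 := by gcongr
      _ = 25 * (r ^ 5 * L ^ 2) / N ^ 2 := by ring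
      _ ≤ (1 / 20 * N) / N ^ 2 := div_le_div_of_nonneg_right (by linarith) (sq_nonneg N)
      _ = 1 / 20 / N := by field_simp
  have hmd : |m * d| ≤ 1 := by
    rw [← sq_le_one_iff_abs_le_one]
    calc (m * d) ^ 2 = m * (m * d ^ 2) := by ring
      _ ≤ r * (1 / 20 / N) := by gcongr
      _ ≤ 1 := by
        rw [← mul_div_assoc, div_le_one hN0]
        linarith
  have hfin : d - phiDeriv r k l + m * d ^ 2 ≤ 1 / (4 * N) := by
    have : 1 / (4 * N) = 1 / 40 / N + 1 / 20 / N + 7 / 40 / N := by field_simp; norm_num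
    have : 0 ≤ 7 / 40 / N := by positivity
    linarith
  have := mul_le_mul_of_nonneg_left hfin (by linarith : 0 ≤ m)
  nlinarith [exp_le_of_abs_le_one hmd]

theorem phiFn_comm {r : ℕ} (hr : 4 ≤ r) {k l : ℝ} (hk : 0 < k) (hl : 0 < l) :
    phiFn r k l = phiFn r l k := by
  rw [phiFn, phiFn, ← alphaFn_inv hr (div_pos hl hk), inv_div, add_comm]

theorem stmt16 (r : ℕ) (hr : 4 ≤ r) (k l : ℝ)
    (hk : 200 * (r : ℝ) ^ 10 ≤ k) (hl : 200 * (r : ℝ) ^ 10 ≤ l)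
    (m : ℝ) (hm : m = 1 ∨ m = 2 ∨ m = (r : ℝ) - 1) :
    Real.exp (phiFn r k l - phiFn r (k - m) l) ≤
      1 + m * (alphaFn r (l / k) / (k + l) -
        deriv (alphaFn r) (l / k) * l * Real.log (k + l) / k ^ 2 + 1 / (4 * (k + l))) ∧
    Real.exp (phiFn r k l - phiFn r k (l - m)) ≤
      1 + m * (alphaFn r (l / k) / (k + l) +
        deriv (alphaFn r) (l / k) * Real.log (k + l) / k + 1 / (4 * (k + l))) := by
  have hr' : (4 : ℝ) ≤ r := by exact_mod_cast hr
  have hm1 : 1 ≤ m := by rcases hm with h | h | h <;> linarith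
  have hmr : m ≤ r := by rcases hm with h | h | h <;> linarith
  refine ⟨?_, exp_phiFn_sub_le hr hk hl hm1 hmr⟩
  have hr9 : (r : ℝ) * 4 ^ 9 ≤ r ^ 10 := by
    rw [show (r : ℝ) ^ 10 = r * r ^ 9 by ring]
    gcongr
  have hk0 : 0 < k := by linarith
  have hl0 : 0 < l := by linarith
  have h := exp_phiFn_sub_le hr hl hk hm1 hmr
  rw [phiFn_comm hr hk0 hl0, phiFn_comm hr (by linarith : 0 < k - m) hl0]
  refine h.trans (le_of_eq ?_)
  have hx := div_pos hl0 hk0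
  rw [(hasDerivAt_alphaFn hr hx).deriv, (hasDerivAt_alphaFn hr (div_pos hk0 hl0)).deriv,
    ← inv_div l k, alphaFn_inv hr hx, add_comm l k]
  have hD : alphaDeriv r (l / k)⁻¹ = -alphaDeriv r (l / k) * (l / k) ^ 2 := by
    simp only [alphaDeriv, inv_inv]
    field_simp
    ring
  rw [hD]
  field_simp
  ring
end
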